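/- Hopf bifurcation of a fixed point. Let n ≥ 1, let M be a topological n-manifold, and let f : [0,1] × M → M be a continuous family of homeomorphisms of M. Suppose p ∈ M is an asymptotically stable fixed point of f₀ (i.e., f₀(p) = p and {p} is an attractor of f₀) and that {p} is a repeller of f_λ for every λ ∈ (0,1]. Then there exists λ₀ > 0 such that for every λ with 0 < λ < λ₀ there exists a compact attractor K_λ of f_λ which is a topological spine of a compact subset of M homeomorphic to S^{n-1} × [0,1] (in particular K_λ has the Borsuk homotopy type of S^{n-1}), and K_λ converges to {p} upper semicontinuously as λ → 0. -/

import Mathlib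

open Set Topology unitInterval

/-- `A` is homeomorphic to an open subset of `B`. -/
def HomeoToOpen (A : Type*) [TopologicalSpace A] (B : Type*) [TopologicalSpace B] : Prop :=
  ∃ U : Set B, IsOpen U ∧ Nonempty (A ≃ₜ U)

/-- The half-space `ℝ^{n-1} × [0,∞)`. -/
abbrev HalfSpace (n : ℕ) : Type :=
  EuclideanSpace ℝ (Fin (n - 1)) × {t : ℝ // 0 ≤ t}

/-- Every point has an open neighborhood homeomorphic to an open subset of `ℝⁿ`. -/
def LocallyEuclidean (n : ℕ) (M : Type*) [TopologicalSpace M] : Prop :=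
  ∀ x : M, ∃ V : Set M, IsOpen V ∧ x ∈ V ∧ HomeoToOpen V (EuclideanSpace ℝ (Fin n))

/-- Every point has an open neighborhood homeomorphic to an open subset of the
half-space `ℝ^{n-1} × [0,∞)`. -/
def LocallyHalfSpace (n : ℕ) (M : Type*) [TopologicalSpace M] : Prop :=
  ∀ x : M, ∃ V : Set M, IsOpen V ∧ x ∈ V ∧ HomeoToOpen V (HalfSpace n)

/-- The manifold boundary of a space: points with no open neighborhood homeomorphic to
an open subset of `ℝⁿ`. -/
def spaceBoundary (n : ℕ) (M : Type*) [TopologicalSpace M] : Set M :=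
  {x | ¬ ∃ V : Set M, IsOpen V ∧ x ∈ V ∧ HomeoToOpen V (EuclideanSpace ℝ (Fin n))}

variable {X : Type*} [TopologicalSpace X]

/-- A subset which is a compact `n`-manifold with boundary (subspace topology). -/
def IsCompactMfldBdry (n : ℕ) (N : Set X) : Prop :=
  IsCompact N ∧ LocallyHalfSpace n ↥N

/-- The boundary of a subset which is a manifold with boundary, as a subset of the
ambient space. -/
def subsetBoundary (n : ℕ) (N : Set X) : Set X :=
  Subtype.val '' spaceBoundary n ↥N

/-- `S` is bicollared in the ambient space. -/
def Bicollared (S : Set X) : Prop :=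
  ∃ b : ↥S × ↥(Set.Icc (-1 : ℝ) 1) → X,
    Topology.IsEmbedding b ∧ ∀ x : ↥S, b (x, ⟨0, by norm_num⟩) = (x : X)

/-- `M` and `N` (compact `n`-manifolds with boundary, `N ⊆ int M`) are concentric:
`M \ int N` is homeomorphic to `∂M × [0,1]`. -/
def Concentric (n : ℕ) (M N : Set X) : Prop :=
  Nonempty (↥(M \ interior N) ≃ₜ ↥(subsetBoundary n M) × ↥(Set.Icc (0 : ℝ) 1))

/-- `K` is a topological spine of the compact `n`-manifold with boundary `N`:
`K ⊆ int N` and `N \ K` is homeomorphic to `∂N × [0,∞)`. -/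
def IsSpine (n : ℕ) (N K : Set X) : Prop :=
  K ⊆ interior N ∧
    Nonempty (↥(N \ K) ≃ₜ ↥(subsetBoundary n N) × ↥(Set.Ici (0 : ℝ)))

/-- The ω-limit set of `Y` under a map `f`. -/
def omegaSet (f : X → X) (Y : Set X) : Set X :=
  ⋂ (n : ℕ) (_ : 1 ≤ n), closure (⋃ (k : ℕ) (_ : n ≤ k), f^[k] '' Y)

/-- `K` is an attractor of the homeomorphism `f`. -/
def IsAttractor (f : X ≃ₜ X) (K : Set X) : Prop :=
  IsCompact K ∧ ∃ U : Set X, U ∈ 𝓝ˢ K ∧ K = omegaSet f U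

/-- `K` is a repeller of the homeomorphism `f`. -/
def IsRepeller (f : X ≃ₜ X) (K : Set X) : Prop :=
  IsAttractor f.symm K

/-- A continuous family of homeomorphisms parametrized by the unit interval. -/
def ContinuousFamily {M : Type*} [TopologicalSpace M] (f : unitInterval → M ≃ₜ M) : Prop :=
  Continuous (fun p : unitInterval × M => f p.1 p.2) ∧
    Continuous (fun p : unitInterval × M => (f p.1).symm p.2)

/-- `M` has the concentric rigidity property (as a subset of the ambient space). -/
def ConcentricRigidity (n : ℕ) (M : Set X) : Prop :=
  ∀ M₀ M₁ : Set X, IsCompactMfldBdry n M₀ → IsCompactMfldBdry n M₁ →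
    M₀ ⊆ interior M₁ → M₁ ⊆ interior M →
    Bicollared (subsetBoundary n M₁) →
    Nonempty (↥(subsetBoundary n M₁) ≃ₜ ↥(subsetBoundary n M)) →
    Concentric n M M₀ →
    Concentric n M₁ M₀ ∧ Concentric n M M₁

section NoRetract
open MeasureTheory

lemma lag_det {n : ℕ} (T : ℝ) (hT : 0 < T) : ∃ (s : Finset ℕ) (v w : ℕ → ℝ), (∀ i ∈ s, 0 < v i ∧ v i ≤ T) ∧
    (∑ i ∈ s, w i = 1) ∧
    ∀ A : EuclideanSpace ℝ (Fin n) →L[ℝ] EuclideanSpace ℝ (Fin n),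
      (1 + A).det = ∑ i ∈ s, w i * (1 + v i • A).det := by
  classical
  set s := Finset.range (n+1) with hs
  set v : ℕ → ℝ := fun i => T / (i + 1) with hv
  have hinj : Set.InjOn v s := by
    intro i _ j _ hij
    simp only [hv] at hij
    have hi : (0:ℝ) < i + 1 := by positivity
    have hj : (0:ℝ) < j + 1 := by positivity
    rw [div_eq_div_iff hi.ne' hj.ne'] at hij
    have := mul_left_cancel₀ hT.ne' hij
    have h : (j:ℝ) = i := by linarith
    exact_mod_cast h.symm
  refine ⟨s, v, fun i => (Lagrange.basis s v i).eval 1, ?_, ?_, ?_⟩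
  · intro i _
    refine ⟨by simp only [hv]; positivity, ?_⟩
    simp only [hv]
    apply div_le_self hT.le
    have : (0:ℝ) ≤ i := by positivity
    linarith
  · have := Lagrange.sum_basis hinj (by simp [hs])
    have h2 := congrArg (Polynomial.eval 1) this
    simpa [Polynomial.eval_finsetSum] using h2
  · intro A
    let b := (EuclideanSpace.basisFun (Fin n) ℝ).toBasis
    set B := LinearMap.toMatrix b b (A : EuclideanSpace ℝ (Fin n) →ₗ[ℝ] EuclideanSpace ℝ (Fin n)) with hB
    set P : Polynomial ℝ := ((Polynomial.X : Polynomial ℝ) • B.map Polynomial.C + (1 : Matrix (Fin n) (Fin n) ℝ).map Polynomial.C).det with hP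
    have hdeg : P.degree < s.card := by
      have := Polynomial.natDegree_det_X_add_C_le B 1
      rw [Fintype.card_fin] at this
      refine lt_of_le_of_lt Polynomial.degree_le_natDegree ?_
      simp only [hs, Finset.card_range]
      exact_mod_cast Nat.lt_succ_of_le this
    have hev : ∀ t : ℝ, P.eval t = (1 + t • A).det := by
      intro t
      rw [hP, ← Polynomial.coe_evalRingHom, RingHom.map_det]
      have : (1 + t • A).det = LinearMap.det ((1 + t • A : EuclideanSpace ℝ (Fin n) →L[ℝ] EuclideanSpace ℝ (Fin n)) : EuclideanSpace ℝ (Fin n) →ₗ[ℝ] EuclideanSpace ℝ (Fin n)) := rfl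
      rw [this, ← LinearMap.det_toMatrix b]
      congr 1
      have : ((1 + t • A : EuclideanSpace ℝ (Fin n) →L[ℝ] EuclideanSpace ℝ (Fin n)) : EuclideanSpace ℝ (Fin n) →ₗ[ℝ] EuclideanSpace ℝ (Fin n)) = LinearMap.id + t • (A : EuclideanSpace ℝ (Fin n) →ₗ[ℝ] EuclideanSpace ℝ (Fin n)) := rfl
      have e9 : LinearMap.toMatrix b b (LinearMap.id + t • (A : EuclideanSpace ℝ (Fin n) →ₗ[ℝ] EuclideanSpace ℝ (Fin n))) = 1 + t • B := by
        rw [map_add, map_smul, LinearMap.toMatrix_id, ← hB]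
      rw [this, e9]
      ext i j
      by_cases hij : i = j
      · subst hij
        simp
        ring
      · simp [hij]
        ring
    have h1 := hev 1
    rw [one_smul] at h1
    rw [← h1, Lagrange.eq_interpolate hinj hdeg, Lagrange.interpolate_apply, Polynomial.eval_finsetSum]
    refine Finset.sum_congr rfl fun i _ => ?_
    simp [hev]
    ring

lemma lip_ext {n : ℕ} (h : EuclideanSpace ℝ (Fin n) → EuclideanSpace ℝ (Fin n)) (L : NNReal)
    (hL : LipschitzOnWith L h (Metric.closedBall 0 1)) (h0 : ∀ x, ‖x‖ = 1 → h x = 0)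
    (hne : ∃ e : EuclideanSpace ℝ (Fin n), ‖e‖ = 1) :
    LipschitzWith L (fun x => if ‖x‖ ≤ 1 then h x else 0) := by
  have key : ∀ x y : EuclideanSpace ℝ (Fin n), ‖x‖ ≤ 1 → 1 < ‖y‖ → ‖h x‖ ≤ L * ‖x - y‖ := by
    intro x y hx hy
    obtain ⟨z, hz, hxz⟩ : ∃ z, ‖z‖ = 1 ∧ ‖x - z‖ = 1 - ‖x‖ := by
      by_cases hx0 : x = 0
      · obtain ⟨e, he⟩ := hne
        exact ⟨e, he, by simp [hx0, he]⟩
      · have hp : 0 < ‖x‖ := norm_pos_iff.2 hx0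
        refine ⟨‖x‖⁻¹ • x, by rw [norm_smul, norm_inv, norm_norm, inv_mul_cancel₀ hp.ne'], ?_⟩
        have : x - ‖x‖⁻¹ • x = (1 - ‖x‖⁻¹) • x := by rw [sub_smul, one_smul]
        rw [this, norm_smul, Real.norm_eq_abs, abs_of_nonpos]
        · field_simp
          ring
        · have := (one_le_inv₀ hp).2 hx
          linarith
    have := hL.dist_le_mul x (by simpa using hx) z (by simp [hz])
    rw [h0 z hz, dist_zero_right, dist_eq_norm, hxz] at this
    refine this.trans (mul_le_mul_of_nonneg_left ?_ L.2)
    have := norm_sub_norm_le y x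
    rw [norm_sub_rev] at this
    linarith
  apply LipschitzWith.of_dist_le_mul
  intro x y
  rw [dist_eq_norm, dist_eq_norm]
  by_cases hx : ‖x‖ ≤ 1 <;> by_cases hy : ‖y‖ ≤ 1
  · simp only [hx, hy, if_true]
    simpa [dist_eq_norm] using hL.dist_le_mul x (by simpa using hx) y (by simpa using hy)
  · simp only [hx, hy, if_true, if_false, sub_zero]
    exact key x y hx (not_le.1 hy)
  · simp only [hx, hy, if_true, if_false, zero_sub, norm_neg]
    rw [norm_sub_rev]
    exact key y x hy (not_le.1 hx)
  · simp only [hx, hy, if_false, sub_zero, norm_zero]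
    positivity

lemma smooth_no_retract {n : ℕ} (G : EuclideanSpace ℝ (Fin n) → EuclideanSpace ℝ (Fin n))
    (hG : ContDiff ℝ 1 G) (h1 : ∀ x, ‖G x‖ = 1) (h2 : ∀ x, ‖x‖ = 1 → G x = x) : False := by
  have hne : ∃ e : EuclideanSpace ℝ (Fin n), ‖e‖ = 1 := ⟨G 0, h1 0⟩
  have hnt : Nontrivial (EuclideanSpace ℝ (Fin n)) := by
    obtain ⟨e, he⟩ := hne
    exact ⟨e, 0, by rintro rfl; simp at he⟩
  set h : EuclideanSpace ℝ (Fin n) → EuclideanSpace ℝ (Fin n) := fun x => G x - x with hh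
  have hC : ContDiff ℝ 1 h := hG.sub contDiff_id
  have hD : Continuous (fderiv ℝ h) := hC.continuous_fderiv one_ne_zero
  obtain ⟨L0, hL0⟩ := (isCompact_closedBall (0 : EuclideanSpace ℝ (Fin n)) 1).exists_bound_of_continuousOn hD.continuousOn
  set L : NNReal := ⟨max L0 0, le_max_right _ _⟩ with hLdef
  have hLb : ∀ x ∈ Metric.closedBall (0 : EuclideanSpace ℝ (Fin n)) 1, ‖fderiv ℝ h x‖ ≤ L := fun x hx =>
    (hL0 x hx).trans (le_max_left _ _)
  have hLip : LipschitzOnWith L h (Metric.closedBall 0 1) :=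
    Convex.lipschitzOnWith_of_nnnorm_fderiv_le (𝕜 := ℝ)
      (fun x _ => (hC.differentiable one_ne_zero) x) (fun x hx => hLb x hx) (convex_closedBall _ _)
  have hExt := lip_ext h L hLip (fun x hx => by simp [hh, h2 x hx]) hne
  set H : EuclideanSpace ℝ (Fin n) → EuclideanSpace ℝ (Fin n) := fun x => if ‖x‖ ≤ 1 then h x else 0 with hH
  obtain ⟨δ, hδ, hdet⟩ : ∃ δ > 0, ∀ A : EuclideanSpace ℝ (Fin n) →L[ℝ] EuclideanSpace ℝ (Fin n),
      ‖A‖ < δ → 0 < (1 + A).det := by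
    have hc : Continuous fun A : EuclideanSpace ℝ (Fin n) →L[ℝ] EuclideanSpace ℝ (Fin n) => (1 + A).det :=
      ContinuousLinearMap.continuous_det.comp (continuous_const.add continuous_id)
    have : ∀ᶠ A in 𝓝 (0 : EuclideanSpace ℝ (Fin n) →L[ℝ] EuclideanSpace ℝ (Fin n)), 0 < (1 + A).det := by
      apply hc.continuousAt.eventually (lt_mem_nhds _)
      have : (1 + (0 : EuclideanSpace ℝ (Fin n) →L[ℝ] EuclideanSpace ℝ (Fin n))).det = 1 := by
        rw [add_zero]
        exact LinearMap.det_id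
      show 0 < (1 + (0 : EuclideanSpace ℝ (Fin n) →L[ℝ] EuclideanSpace ℝ (Fin n))).det
      rw [this]; exact one_pos
    obtain ⟨δ, hδ, hb⟩ := Metric.eventually_nhds_iff.1 this
    exact ⟨δ, hδ, fun A hA => hb (by simpa using hA)⟩
  set T : ℝ := min 1 δ / (2 * (L + 1)) with hTdef
  have hLn : (0:ℝ) ≤ L := L.2
  have hm : 0 < min 1 δ := lt_min one_pos hδ
  have hT : 0 < T := by positivity
  have hTL : T * L < min 1 δ := by
    rw [hTdef, div_mul_eq_mul_div, div_lt_iff₀ (by positivity)]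
    nlinarith
  set B := Metric.ball (0 : EuclideanSpace ℝ (Fin n)) 1 with hB
  have main : ∀ t : ℝ, 0 < t → t ≤ T → ∫ x in B, (1 + t • fderiv ℝ h x).det = volume.real B := by
    intro t ht0 htT
    have htL : t * L < min 1 δ := lt_of_le_of_lt (mul_le_mul_of_nonneg_right htT hLn) hTL
    set F : EuclideanSpace ℝ (Fin n) → EuclideanSpace ℝ (Fin n) := fun x => x + t • H x with hF
    have hap : ApproximatesLinearOn F ((ContinuousLinearEquiv.refl ℝ (EuclideanSpace ℝ (Fin n)) : EuclideanSpace ℝ (Fin n) ≃L[ℝ] EuclideanSpace ℝ (Fin n)) : EuclideanSpace ℝ (Fin n) →L[ℝ] EuclideanSpace ℝ (Fin n)) univ (t.toNNReal * L) := by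
      intro x _ y _
      have : F x - F y - ((ContinuousLinearEquiv.refl ℝ (EuclideanSpace ℝ (Fin n)) : EuclideanSpace ℝ (Fin n) ≃L[ℝ] EuclideanSpace ℝ (Fin n)) : EuclideanSpace ℝ (Fin n) →L[ℝ] EuclideanSpace ℝ (Fin n)) (x - y) = t • (H x - H y) := by
        simp [hF, smul_sub]; abel
      rw [this, norm_smul, Real.norm_eq_abs, abs_of_pos ht0]
      have := hExt.dist_le_mul x y
      rw [dist_eq_norm, dist_eq_norm] at this
      calc t * ‖H x - H y‖ ≤ t * (L * ‖x - y‖) := mul_le_mul_of_nonneg_left this ht0.le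
        _ = _ := by rw [NNReal.coe_mul, Real.coe_toNNReal _ ht0.le, mul_assoc]
    have hc : (t.toNNReal * L : NNReal) < ‖((ContinuousLinearEquiv.refl ℝ (EuclideanSpace ℝ (Fin n))).symm : EuclideanSpace ℝ (Fin n) →L[ℝ] EuclideanSpace ℝ (Fin n))‖₊⁻¹ := by
      have : ‖((ContinuousLinearEquiv.refl ℝ (EuclideanSpace ℝ (Fin n))).symm : EuclideanSpace ℝ (Fin n) →L[ℝ] EuclideanSpace ℝ (Fin n))‖₊ = 1 := by
        ext
        exact ContinuousLinearMap.norm_id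
      rw [this, inv_one, ← NNReal.coe_lt_coe]
      rw [NNReal.coe_mul, Real.coe_toNNReal _ ht0.le]
      exact lt_of_lt_of_le htL (min_le_left _ _)
    have hsurj := hap.surjective (Or.inr hc)
    have hinj : Function.Injective F := injOn_univ.1 (hap.injOn (Or.inr hc))
    have hout : ∀ x, x ∉ B → F x = x := by
      intro x hx
      have hx1 : 1 ≤ ‖x‖ := by simpa [hB] using hx
      simp only [hF, hH]
      split_ifs with h3
      · simp [hh, h2 x (le_antisymm h3 hx1)]
      · simp
    have himg : F '' B = B := by
      ext y
      constructor
      · rintro ⟨x, hx, rfl⟩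
        by_contra hc
        have := hinj (hout _ hc)
        rw [this] at hc
        exact hc hx
      · intro hy
        obtain ⟨x, rfl⟩ := hsurj y
        by_cases hx : x ∈ B
        · exact ⟨x, hx, rfl⟩
        · rw [hout x hx] at hy; exact absurd hy hx
    have hder : ∀ x ∈ B, HasFDerivWithinAt F (1 + t • fderiv ℝ h x) B x := by
      intro x hx
      have hd : HasFDerivAt h (fderiv ℝ h x) x := ((hC.differentiable one_ne_zero) x).hasFDerivAt
      have hd2 : HasFDerivAt (fun x => x + t • h x) (1 + t • fderiv ℝ h x) x :=
        (hasFDerivAt_id x).add (hd.const_smul t)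
      refine (hd2.hasFDerivWithinAt).congr (fun y hy => ?_) ?_
      · have : ‖y‖ ≤ 1 := by have := mem_ball_zero_iff.1 hy; exact this.le
        simp [hF, hH, this]
      · have : ‖x‖ ≤ 1 := by have := mem_ball_zero_iff.1 hx; exact this.le
        simp [hF, hH, this]
    have hcv := integral_image_eq_integral_abs_det_fderiv_smul volume (Metric.isOpen_ball.measurableSet) hder
      hinj.injOn (fun _ => (1:ℝ))
    rw [himg] at hcv
    simp only [smul_eq_mul, mul_one] at hcv
    rw [setIntegral_const, smul_eq_mul, mul_one] at hcv
    rw [hcv]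
    refine setIntegral_congr_fun Metric.isOpen_ball.measurableSet fun x hx => ?_
    refine (abs_of_pos (hdet _ ?_)).symm
    rw [norm_smul, Real.norm_eq_abs, abs_of_pos ht0]
    refine lt_of_le_of_lt (mul_le_mul_of_nonneg_left (hLb x (Metric.ball_subset_closedBall hx)) ht0.le) (lt_of_lt_of_le htL (min_le_right _ _))
  obtain ⟨s, v, w, hv, hw, hlag⟩ := lag_det (n := n) T hT
  have hint : ∀ t : ℝ, IntegrableOn (fun x => (1 + t • fderiv ℝ h x).det) B := by
    intro t
    have : Continuous (fun x => (1 + t • fderiv ℝ h x).det) :=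
      ContinuousLinearMap.continuous_det.comp (continuous_const.add (hD.const_smul t))
    exact (this.continuousOn.integrableOn_compact (isCompact_closedBall _ _)).mono_set Metric.ball_subset_closedBall
  have hone : ∫ x in B, (1 + fderiv ℝ h x).det = volume.real B := by
    rw [setIntegral_congr_fun Metric.isOpen_ball.measurableSet (fun x _ => hlag (fderiv ℝ h x))]
    rw [integral_finsetSum _ (fun i _ => (hint (v i)).const_mul (w i))]
    simp_rw [integral_const_mul]
    rw [Finset.sum_congr rfl (fun i hi => by rw [main (v i) (hv i hi).1 (hv i hi).2])]
    rw [← Finset.sum_mul, hw, one_mul]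
  have hzero : ∀ x, (1 + fderiv ℝ h x).det = 0 := by
    intro x
    have hd : HasFDerivAt G (fderiv ℝ G x) x := ((hG.differentiable one_ne_zero) x).hasFDerivAt
    have hfd : fderiv ℝ h x = fderiv ℝ G x - 1 := (hd.sub (hasFDerivAt_id x)).fderiv
    rw [hfd, add_sub_cancel]
    have horth : ∀ u, inner ℝ (G x) (fderiv ℝ G x u) = 0 := by
      intro u
      have e1 := (hd.inner ℝ hd)
      have e2 : (fun t => inner ℝ (G t) (G t)) = fun _ => (1:ℝ) := by
        ext t; rw [real_inner_self_eq_norm_sq, h1]; norm_num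
      rw [e2] at e1
      have e3 := e1.unique (hasFDerivAt_const (1:ℝ) x)
      have e4 := congrArg (fun l => l u) e3
      simp [real_inner_comm (G x)] at e4
      exact e4
    by_contra hne0
    have hsur : Function.Surjective (fderiv ℝ G x) := by
      have hu : IsUnit (LinearMap.det (fderiv ℝ G x : EuclideanSpace ℝ (Fin n) →ₗ[ℝ] EuclideanSpace ℝ (Fin n))) := isUnit_iff_ne_zero.2 hne0
      have := (LinearMap.isUnit_iff_isUnit_det _).2 hu
      exact ((Module.End.isUnit_iff _).1 this).2
    obtain ⟨u, hu⟩ := hsur (G x)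
    have := horth u
    rw [hu, real_inner_self_eq_norm_sq, h1] at this
    norm_num at this
  simp_rw [hzero] at hone
  rw [integral_zero] at hone
  have : 0 < volume.real B := by
    rw [measureReal_def]
    exact ENNReal.toReal_pos (Metric.measure_ball_pos _ _ one_pos).ne' measure_ball_lt_top.ne
  linarith

lemma no_retract {n : ℕ} (F : EuclideanSpace ℝ (Fin n) → EuclideanSpace ℝ (Fin n))
    (hF : ContinuousOn F (Metric.closedBall 0 1)) (h0 : ∀ x ∈ Metric.closedBall (0 : EuclideanSpace ℝ (Fin n)) 1, F x ≠ 0)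
    (h1 : ∀ x, ‖x‖ = 1 → F x = x) : False := by
  classical
  set F' : EuclideanSpace ℝ (Fin n) → EuclideanSpace ℝ (Fin n) := fun x => if ‖x‖ ≤ 1 then F x else x with hF'
  have hc : Continuous F' := by
    apply continuous_if_le continuous_norm continuous_const
    · have e : {x : EuclideanSpace ℝ (Fin n) | ‖x‖ ≤ 1} = Metric.closedBall 0 1 := by
        ext x; simp
      rw [e]; exact hF
    · exact continuousOn_id
    · exact fun x hx => h1 x hx
  have hne : ∀ x, F' x ≠ 0 := by
    intro x
    simp only [hF']
    split_ifs with h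
    · exact h0 x (by simpa using h)
    · rintro rfl; simp at h
  obtain ⟨g, hg, hgd, hgs⟩ := Continuous.exists_contDiff_approx (f := fun x => F' x - x) (ε := fun x => ‖F' x‖) 1
    (hc.sub continuous_id) hc.norm (fun x => norm_pos_iff.2 (hne x))
  have hne2 : ∀ x, x + g x ≠ 0 := by
    intro x hx
    have := hgd x
    rw [dist_eq_norm] at this
    have e : g x - (F' x - x) = - F' x := by
      have : g x = - x := by rw [eq_neg_iff_add_eq_zero, add_comm]; exact hx
      rw [this]; abel
    rw [e, norm_neg] at this
    exact lt_irrefl _ this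
  have hs : ContDiff ℝ 1 (fun x => x + g x) := contDiff_id.add hg
  refine smooth_no_retract (fun x => ‖x + g x‖⁻¹ • (x + g x)) ?_ ?_ ?_
  · exact ((hs.norm ℝ hne2).inv (fun x => (norm_pos_iff.2 (hne2 x)).ne')).smul hs
  · intro x
    rw [norm_smul, norm_inv, norm_norm, inv_mul_cancel₀ (norm_pos_iff.2 (hne2 x)).ne']
  · intro x hx
    have : g x = 0 := by
      by_contra hgx
      have := hgs hgx
      simp [hF', hx, h1 x hx] at this
    simp [this, hx]

end NoRetract

section Bdry

def shell (n : ℕ) (c a : ℝ) : Set (EuclideanSpace ℝ (Fin n)) := {x | c ≤ ‖x‖ ∧ ‖x‖ ≤ a}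

lemma no_retract' {n : ℕ} (F : ↥(Metric.closedBall (0 : EuclideanSpace ℝ (Fin n)) 1) → EuclideanSpace ℝ (Fin n))
    (hF : Continuous F) (h0 : ∀ x, F x ≠ 0)
    (h1 : ∀ x : ↥(Metric.closedBall (0 : EuclideanSpace ℝ (Fin n)) 1), ‖(x : EuclideanSpace ℝ (Fin n))‖ = 1 → F x = x) : False := by
  classical
  refine no_retract (fun x => if h : x ∈ Metric.closedBall (0 : EuclideanSpace ℝ (Fin n)) 1 then F ⟨x, h⟩ else 0) ?_ ?_ ?_
  · rw [continuousOn_iff_continuous_domRestrict]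
    convert hF using 1
    ext x : 1
    simp only [domRestrict_apply]
    rw [dif_pos x.2]
  · intro x hx
    simp only [hx, dif_pos]
    exact h0 _
  · intro x hx
    have hx' : x ∈ Metric.closedBall (0 : EuclideanSpace ℝ (Fin n)) 1 := by simp [hx]
    simp only [hx', dif_pos]
    exact h1 ⟨x, hx'⟩ hx

lemma outer_bdry {n : ℕ} {c a : ℝ} (hc : 0 < c) (hca : c < a) (y : ↥(shell n c a))
    (hy : ‖(y : EuclideanSpace ℝ (Fin n))‖ = a) : y ∈ spaceBoundary n ↥(shell n c a) := by
  rintro ⟨V, hVo, hyV, U, hUo, ⟨e⟩⟩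
  set u0 : U := e ⟨y, hyV⟩ with hu0
  obtain ⟨ε0, hε0, hεV⟩ := Metric.isOpen_iff.1 hVo y hyV
  obtain ⟨ε, hε, hεε, hεa⟩ : ∃ ε > 0, ε ≤ ε0 ∧ ε ≤ a - c :=
    ⟨min ε0 (a - c), lt_min hε0 (by linarith), min_le_left _ _, min_le_right _ _⟩
  have hW : ∀ x : EuclideanSpace ℝ (Fin n), x ∈ Metric.ball (y : EuclideanSpace ℝ (Fin n)) ε → x ∈ Metric.closedBall (0 : EuclideanSpace ℝ (Fin n)) a →
      ∃ h : x ∈ shell n c a, (⟨x, h⟩ : ↥(shell n c a)) ∈ V := by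
    intro x hx hxa
    have hxa' : ‖x‖ ≤ a := by simpa using hxa
    have h1 : dist x y < ε := hx
    have h2 : c ≤ ‖x‖ := by
      have := norm_sub_norm_le (y : EuclideanSpace ℝ (Fin n)) x
      rw [← dist_eq_norm, dist_comm, hy] at this
      linarith
    exact ⟨⟨h2, hxa'⟩, hεV (show dist x y < ε0 by linarith)⟩
  obtain ⟨δ1, hδ1, hU1⟩ := Metric.isOpen_iff.1 hUo u0 u0.2
  obtain ⟨δ2, hδ2, hU2⟩ := Metric.continuousAt_iff.1 (e.symm.continuous.continuousAt (x := u0)) ε hε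
  set ρ := min δ1 δ2 / 2 with hρ
  have hmin : 0 < min δ1 δ2 := lt_min hδ1 hδ2
  have hρ0 : 0 < ρ := by positivity
  have hρ1 : ρ < δ1 := by have := min_le_left δ1 δ2; linarith
  have hρ2 : ρ < δ2 := by have := min_le_right δ1 δ2; linarith
  have hbn : ∀ b : ↥(Metric.closedBall (0 : EuclideanSpace ℝ (Fin n)) 1), ‖(b : EuclideanSpace ℝ (Fin n))‖ ≤ 1 :=
    fun b => mem_closedBall_zero_iff.1 b.2
  have hd : ∀ b : ↥(Metric.closedBall (0 : EuclideanSpace ℝ (Fin n)) 1),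
      dist ((u0 : EuclideanSpace ℝ (Fin n)) + ρ • (b : EuclideanSpace ℝ (Fin n))) u0 ≤ ρ := by
    intro b
    rw [dist_eq_norm, add_sub_cancel_left, norm_smul, Real.norm_eq_abs, abs_of_pos hρ0]
    have := hbn b
    nlinarith
  let k : ↥(Metric.closedBall (0 : EuclideanSpace ℝ (Fin n)) 1) → U := fun b =>
    ⟨(u0 : EuclideanSpace ℝ (Fin n)) + ρ • (b : EuclideanSpace ℝ (Fin n)), hU1 (lt_of_le_of_lt (hd b) hρ1)⟩
  have hk : Continuous k := by
    apply Continuous.subtype_mk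
    fun_prop
  let q : ↥(Metric.closedBall (0 : EuclideanSpace ℝ (Fin n)) 1) → EuclideanSpace ℝ (Fin n) := fun b => ((e.symm (k b) : V) : ↥(shell n c a))
  have hq : Continuous q := continuous_subtype_val.comp (continuous_subtype_val.comp (e.symm.continuous.comp hk))
  have hsy : e.symm u0 = ⟨y, hyV⟩ := by simp [hu0]
  have hq1 : ∀ b, q b ∈ Metric.ball (y : EuclideanSpace ℝ (Fin n)) ε := by
    intro b
    have := hU2 (x := k b) (lt_of_le_of_lt (hd b) hρ2)
    rw [hsy] at this
    exact this
  have hq2 : ∀ b, q b ∈ Metric.closedBall (0 : EuclideanSpace ℝ (Fin n)) a := by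
    intro b
    have := ((e.symm (k b) : V) : ↥(shell n c a)).2.2
    simpa [q] using this
  have ha : 0 < a := hc.trans hca
  set τ := ε / (2 * a) with hτ
  have hτ0 : 0 < τ := by positivity
  have hτa : τ * a = ε / 2 := by rw [hτ]; field_simp
  have hτ1 : τ < 1 := by
    by_contra hcon
    push Not at hcon
    nlinarith
  set c0 : EuclideanSpace ℝ (Fin n) := (1 - τ) • (y : EuclideanSpace ℝ (Fin n)) with hc0
  have hc0n : ‖c0‖ < a := by
    rw [hc0, norm_smul, hy, Real.norm_eq_abs, abs_of_pos (by linarith)]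
    nlinarith
  have hc01 : c0 ∈ Metric.ball (y : EuclideanSpace ℝ (Fin n)) ε := by
    rw [Metric.mem_ball, dist_eq_norm]
    have : c0 - y = (-τ) • (y : EuclideanSpace ℝ (Fin n)) := by rw [hc0]; module
    rw [this, norm_smul, hy, Real.norm_eq_abs, abs_neg, abs_of_pos hτ0, hτa]
    linarith
  have hc02 : c0 ∈ Metric.closedBall (0 : EuclideanSpace ℝ (Fin n)) a := by simpa using hc0n.le
  let Q : ↥(Metric.closedBall (0 : EuclideanSpace ℝ (Fin n)) 1) → EuclideanSpace ℝ (Fin n) := fun b =>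
    ‖(b : EuclideanSpace ℝ (Fin n))‖ • q b + (1 - ‖(b : EuclideanSpace ℝ (Fin n))‖) • c0
  have hQ : Continuous Q := by
    have : Continuous fun b : ↥(Metric.closedBall (0 : EuclideanSpace ℝ (Fin n)) 1) => ‖(b : EuclideanSpace ℝ (Fin n))‖ := by fun_prop
    exact (this.smul hq).add ((continuous_const.sub this).smul continuous_const)
  have hQ1 : ∀ b, Q b ∈ Metric.ball (y : EuclideanSpace ℝ (Fin n)) ε := fun b =>
    (convex_ball _ _) (hq1 b) hc01 (norm_nonneg _) (sub_nonneg.2 (hbn b)) (by ring)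
  have hQ2 : ∀ b, Q b ∈ Metric.closedBall (0 : EuclideanSpace ℝ (Fin n)) a := fun b =>
    (convex_closedBall _ _) (hq2 b) hc02 (norm_nonneg _) (sub_nonneg.2 (hbn b)) (by ring)
  have hQy : ∀ b, Q b ≠ y := by
    intro b hb
    rcases (hbn b).lt_or_eq with hlt | heq
    · have h1 : ‖Q b‖ < a := by
        calc ‖Q b‖ ≤ ‖‖(b : EuclideanSpace ℝ (Fin n))‖ • q b‖ + ‖(1 - ‖(b : EuclideanSpace ℝ (Fin n))‖) • c0‖ := norm_add_le _ _
          _ = ‖(b : EuclideanSpace ℝ (Fin n))‖ * ‖q b‖ + (1 - ‖(b : EuclideanSpace ℝ (Fin n))‖) * ‖c0‖ := by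
            rw [norm_smul, norm_smul, norm_norm, Real.norm_eq_abs, abs_of_pos (by linarith)]
          _ < a := by
            have h3 : ‖q b‖ ≤ a := by simpa using hq2 b
            have h4 := norm_nonneg (b : EuclideanSpace ℝ (Fin n))
            nlinarith
      rw [hb, hy] at h1
      exact lt_irrefl _ h1
    · have h1 : q b = y := by
        have : Q b = q b := by simp [Q, heq]
        rw [← this, hb]
      have h2 : e.symm (k b) = e.symm u0 := by
        rw [hsy]
        exact Subtype.ext (Subtype.ext h1)
      have h3 := congrArg (Subtype.val) (e.symm.injective h2)
      simp only [k, add_eq_left, smul_eq_zero, hρ0.ne', false_or] at h3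
      rw [h3] at heq
      simp at heq
  let QV : ↥(Metric.closedBall (0 : EuclideanSpace ℝ (Fin n)) 1) → V := fun b =>
    ⟨⟨Q b, (hW _ (hQ1 b) (hQ2 b)).1⟩, (hW _ (hQ1 b) (hQ2 b)).2⟩
  have hQV : Continuous QV := by
    apply Continuous.subtype_mk
    apply Continuous.subtype_mk
    exact hQ
  refine no_retract' (fun b => ρ⁻¹ • ((e (QV b) : EuclideanSpace ℝ (Fin n)) - u0)) ?_ ?_ ?_
  · exact ((continuous_subtype_val.comp (e.continuous.comp hQV)).fun_sub continuous_const).fun_const_smul _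
  · intro b hb
    rw [smul_eq_zero] at hb
    rcases hb with hb | hb
    · exact hρ0.ne' (inv_eq_zero.1 hb)
    · have h1 : e (QV b) = e ⟨y, hyV⟩ := Subtype.ext (sub_eq_zero.1 hb)
      have h2 := e.injective h1
      exact hQy b (congrArg (fun z : V => (z.1 : EuclideanSpace ℝ (Fin n))) h2)
  · intro b hb
    have h1 : QV b = e.symm (k b) := by
      apply Subtype.ext; apply Subtype.ext
      simp [QV, Q, hb, q]
    rw [h1, e.apply_symm_apply]
    simp only [k, add_sub_cancel_left]
    rw [smul_smul, inv_mul_cancel₀ hρ0.ne', one_smul]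

lemma bdry_homeo {n : ℕ} {Y Z : Type*} [TopologicalSpace Y] [TopologicalSpace Z] (e : Y ≃ₜ Z) (y : Y)
    (hy : y ∈ spaceBoundary n Y) : e y ∈ spaceBoundary n Z := by
  rintro ⟨V, hVo, hyV, U, hUo, ⟨g⟩⟩
  refine hy ⟨e ⁻¹' V, hVo.preimage e.continuous, hyV, U, hUo, ⟨Homeomorph.trans ?_ g⟩⟩
  exact e.subtype (fun x => Iff.rfl)

noncomputable def shellInv (n : ℕ) (c a : ℝ) (hc : 0 < c) (hca : c < a) : ↥(shell n c a) ≃ₜ ↥(shell n c a) :=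
  have hpos : ∀ x : ↥(shell n c a), 0 < ‖(x : EuclideanSpace ℝ (Fin n))‖ := fun x => lt_of_lt_of_le hc x.2.1
  have hn : ∀ x : ↥(shell n c a), ‖(c * a / ‖(x : EuclideanSpace ℝ (Fin n))‖ ^ 2) • (x : EuclideanSpace ℝ (Fin n))‖ = c * a / ‖(x : EuclideanSpace ℝ (Fin n))‖ := by
    intro x
    have h := hpos x
    have : 0 < a := hc.trans hca
    rw [norm_smul, Real.norm_eq_abs, abs_of_pos (by positivity)]
    field_simp
  have hm : ∀ x : ↥(shell n c a), (c * a / ‖(x : EuclideanSpace ℝ (Fin n))‖ ^ 2) • (x : EuclideanSpace ℝ (Fin n)) ∈ shell n c a := by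
    intro x
    have h := hpos x
    have ha : 0 < a := hc.trans hca
    refine ⟨?_, ?_⟩
    · rw [hn, le_div_iff₀ h]; exact mul_le_mul_of_nonneg_left x.2.2 hc.le
    · rw [hn, div_le_iff₀ h, mul_comm]; exact mul_le_mul_of_nonneg_left x.2.1 ha.le
  have hinv : ∀ x : ↥(shell n c a), (⟨_, hm ⟨_, hm x⟩⟩ : ↥(shell n c a)) = x := by
    intro x
    apply Subtype.ext
    simp only
    rw [hn, smul_smul]
    have h := hpos x
    have ha : 0 < a := hc.trans hca
    have : c * a / (c * a / ‖(x : EuclideanSpace ℝ (Fin n))‖) ^ 2 * (c * a / ‖(x : EuclideanSpace ℝ (Fin n))‖ ^ 2) = 1 := by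
      field_simp
    rw [this, one_smul]
  have hcont : Continuous (fun x : ↥(shell n c a) => (⟨_, hm x⟩ : ↥(shell n c a))) := by
    apply Continuous.subtype_mk
    apply Continuous.fun_smul _ continuous_subtype_val
    apply Continuous.div continuous_const (by fun_prop)
    intro x
    exact pow_ne_zero 2 (hpos x).ne'
  { toFun := fun x => ⟨_, hm x⟩
    invFun := fun x => ⟨_, hm x⟩
    left_inv := hinv
    right_inv := hinv
    continuous_toFun := hcont
    continuous_invFun := hcont }

lemma inner_bdry {n : ℕ} {c a : ℝ} (hc : 0 < c) (hca : c < a) (y : ↥(shell n c a))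
    (hy : ‖(y : EuclideanSpace ℝ (Fin n))‖ = c) : y ∈ spaceBoundary n ↥(shell n c a) := by
  have h := outer_bdry hc hca (shellInv n c a hc hca y) (by
    show ‖(c * a / ‖(y : EuclideanSpace ℝ (Fin n))‖ ^ 2) • (y : EuclideanSpace ℝ (Fin n))‖ = a
    have ha : 0 < a := hc.trans hca
    rw [norm_smul, Real.norm_eq_abs, hy, abs_of_pos (by positivity)]
    field_simp)
  have := bdry_homeo (shellInv n c a hc hca).symm _ h
  simpa using this

lemma shell_bdry {n : ℕ} {c a : ℝ} (hc : 0 < c) (hca : c < a) (y : ↥(shell n c a)) :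
    y ∈ spaceBoundary n ↥(shell n c a) ↔ ‖(y : EuclideanSpace ℝ (Fin n))‖ = a ∨ ‖(y : EuclideanSpace ℝ (Fin n))‖ = c := by
  constructor
  · intro h
    by_contra hcon
    push Not at hcon
    apply h
    have hU : IsOpen {x : EuclideanSpace ℝ (Fin n) | c < ‖x‖ ∧ ‖x‖ < a} :=
      (isOpen_lt continuous_const continuous_norm).inter (isOpen_lt continuous_norm continuous_const)
    refine ⟨Subtype.val ⁻¹' {x : EuclideanSpace ℝ (Fin n) | c < ‖x‖ ∧ ‖x‖ < a}, hU.preimage continuous_subtype_val,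
      ⟨lt_of_le_of_ne y.2.1 hcon.2.symm, lt_of_le_of_ne y.2.2 hcon.1⟩, _, hU, ⟨?_⟩⟩
    exact
    { toFun := fun x => ⟨x.1.1, x.2⟩
      invFun := fun x => ⟨⟨x.1, x.2.1.le, x.2.2.le⟩, x.2⟩
      left_inv := fun x => rfl
      right_inv := fun x => rfl
      continuous_toFun := by fun_prop
      continuous_invFun := by fun_prop }
  · rintro (h | h)
    · exact outer_bdry hc hca y h
    · exact inner_bdry hc hca y h

lemma subset_bdry {n : ℕ} {c a : ℝ} (hc : 0 < c) (hca : c < a) {M : Type*} [TopologicalSpace M] [T2Space M]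
    (φ : EuclideanSpace ℝ (Fin n) → M) (hφ : IsOpenEmbedding φ) :
    Nonempty (↥(subsetBoundary n (φ '' shell n c a)) ≃ₜ
      (↥(Metric.sphere (0 : EuclideanSpace ℝ (Fin n)) 1) ⊕ ↥(Metric.sphere (0 : EuclideanSpace ℝ (Fin n)) 1))) := by
  have ha : 0 < a := hc.trans hca
  let j : (↥(Metric.sphere (0 : EuclideanSpace ℝ (Fin n)) 1) ⊕ ↥(Metric.sphere (0 : EuclideanSpace ℝ (Fin n)) 1)) → M :=
    Sum.elim (fun v => φ (a • (v : EuclideanSpace ℝ (Fin n)))) (fun v => φ (c • (v : EuclideanSpace ℝ (Fin n))))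
  have hnv : ∀ v : ↥(Metric.sphere (0 : EuclideanSpace ℝ (Fin n)) 1), ‖(v : EuclideanSpace ℝ (Fin n))‖ = 1 := fun v => by simp
  have hns : ∀ (t : ℝ), 0 < t → ∀ v : ↥(Metric.sphere (0 : EuclideanSpace ℝ (Fin n)) 1), ‖t • (v : EuclideanSpace ℝ (Fin n))‖ = t := by
    intro t ht v
    rw [norm_smul, hnv, mul_one, Real.norm_eq_abs, abs_of_pos ht]
  have hj : Continuous j := by
    apply Continuous.sumElim
    · exact hφ.continuous.comp (by fun_prop)
    · exact hφ.continuous.comp (by fun_prop)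
  have hinj : Function.Injective j := by
    rintro (v | v) (w | w) h
    · have h1 := hφ.injective h
      rw [Subtype.ext (smul_right_injective _ ha.ne' h1)]
    · have h1 := congrArg norm (hφ.injective h)
      rw [hns a ha, hns c hc] at h1
      exact absurd h1 hca.ne'
    · have h1 := congrArg norm (hφ.injective h)
      rw [hns a ha, hns c hc] at h1
      exact absurd h1 hca.ne
    · have h1 := hφ.injective h
      rw [Subtype.ext (smul_right_injective _ hc.ne' h1)]
  have hemb := hj.isClosedEmbedding hinj
  have hbd : ∀ x (hx : x ∈ shell n c a), φ x ∈ subsetBoundary n (φ '' shell n c a) ↔ ‖x‖ = a ∨ ‖x‖ = c := by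
    intro x hx
    let g := hφ.isEmbedding.homeomorphImage (shell n c a)
    rw [← shell_bdry hc hca ⟨x, hx⟩]
    constructor
    · rintro ⟨z, hz, hzx⟩
      have h1 := bdry_homeo g.symm z hz
      have h2 : g.symm z = ⟨x, hx⟩ := by
        rw [Homeomorph.symm_apply_eq]
        exact Subtype.ext hzx
      rwa [h2] at h1
    · intro h
      exact ⟨g ⟨x, hx⟩, bdry_homeo g _ h, rfl⟩
  have hrange : range j = subsetBoundary n (φ '' shell n c a) := by
    ext z
    constructor
    · rintro ⟨v | v, rfl⟩
      · exact (hbd _ ⟨by rw [hns a ha]; exact hca.le, by rw [hns a ha]⟩).2 (Or.inl (hns a ha v))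
      · exact (hbd _ ⟨by rw [hns c hc], by rw [hns c hc]; exact hca.le⟩).2 (Or.inr (hns c hc v))
    · intro hz
      obtain ⟨⟨z', x, hx, rfl⟩, hz', rfl⟩ := id hz
      rcases (hbd x hx).1 hz with h | h
      · refine ⟨Sum.inl ⟨a⁻¹ • x, by rw [mem_sphere_zero_iff_norm, norm_smul, h, norm_inv, Real.norm_eq_abs, abs_of_pos ha, inv_mul_cancel₀ ha.ne']⟩, ?_⟩
        simp [j, smul_smul, mul_inv_cancel₀ ha.ne']
      · refine ⟨Sum.inr ⟨c⁻¹ • x, by rw [mem_sphere_zero_iff_norm, norm_smul, h, norm_inv, Real.norm_eq_abs, abs_of_pos hc, inv_mul_cancel₀ hc.ne']⟩, ?_⟩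
        simp [j, smul_smul, mul_inv_cancel₀ hc.ne']
  rw [← hrange]
  exact ⟨hemb.isEmbedding.toHomeomorph.symm⟩

lemma polar {n : ℕ} {T : Type*} [TopologicalSpace T] (J : Set ℝ) (hJ : ∀ s ∈ J, 0 < s) (r : T ≃ₜ J) :
    Nonempty (↥{x : EuclideanSpace ℝ (Fin n) | ‖x‖ ∈ J} ≃ₜ ↥(Metric.sphere (0 : EuclideanSpace ℝ (Fin n)) 1) × T) := by
  have hp : ∀ x : ↥{x : EuclideanSpace ℝ (Fin n) | ‖x‖ ∈ J}, 0 < ‖(x : EuclideanSpace ℝ (Fin n))‖ := fun x => hJ _ x.2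
  have hns : ∀ (t : ℝ), 0 < t → ∀ v : ↥(Metric.sphere (0 : EuclideanSpace ℝ (Fin n)) 1), ‖t • (v : EuclideanSpace ℝ (Fin n))‖ = t := by
    intro t ht v
    have : ‖(v : EuclideanSpace ℝ (Fin n))‖ = 1 := by simp
    rw [norm_smul, this, mul_one, Real.norm_eq_abs, abs_of_pos ht]
  have hrp : ∀ t, 0 < (r t : ℝ) := fun t => hJ _ (r t).2
  refine ⟨{ toFun := fun x => (⟨‖(x : EuclideanSpace ℝ (Fin n))‖⁻¹ • (x : EuclideanSpace ℝ (Fin n)), ?_⟩, r.symm ⟨‖(x : EuclideanSpace ℝ (Fin n))‖, x.2⟩)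
            invFun := fun q => ⟨(r q.2 : ℝ) • (q.1 : EuclideanSpace ℝ (Fin n)), ?_⟩
            left_inv := ?_
            right_inv := ?_
            continuous_toFun := ?_
            continuous_invFun := ?_ }⟩
  · rw [mem_sphere_zero_iff_norm, norm_smul, norm_inv, norm_norm, inv_mul_cancel₀ (hp x).ne']
  · show ‖_‖ ∈ J
    rw [hns _ (hrp _)]
    exact (r q.2).2
  · intro x
    apply Subtype.ext
    simp [smul_smul, mul_inv_cancel₀ (hp x).ne']
  · intro q
    have h1 := hns _ (hrp q.2) q.1
    apply Prod.ext
    · apply Subtype.ext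
      simp only [h1]
      rw [smul_smul, inv_mul_cancel₀ (hrp q.2).ne', one_smul]
    · simp only [h1]
      simp
  · apply Continuous.prodMk
    · apply Continuous.subtype_mk
      apply Continuous.fun_smul _ continuous_subtype_val
      exact Continuous.inv₀ (by fun_prop) (fun x => (hp x).ne')
    · exact r.symm.continuous.comp (Continuous.subtype_mk (by fun_prop) _)
  · apply Continuous.subtype_mk
    apply Continuous.fun_smul
    · exact continuous_subtype_val.comp (r.continuous.comp continuous_snd)
    · fun_prop

lemma ray_Ioc (a : ℝ) (ha : 0 < a) : Nonempty (↥(Set.Ici (0:ℝ)) ≃ₜ ↥(Set.Ioc (0:ℝ) a)) := by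
  have h1 : ∀ t : ↥(Set.Ici (0:ℝ)), 0 < 1 + (t:ℝ) := fun t => by have := t.2; simp only [mem_Ici] at this; linarith
  refine ⟨{ toFun := fun t => ⟨a / (1 + t), ?_, ?_⟩
            invFun := fun s => ⟨a / s - 1, ?_⟩
            left_inv := ?_
            right_inv := ?_
            continuous_toFun := ?_
            continuous_invFun := ?_ }⟩
  · have := h1 t; positivity
  · rw [div_le_iff₀ (h1 t)]
    have := t.2; simp only [mem_Ici] at this; nlinarith
  · have := s.2
    simp only [mem_Ici, sub_nonneg]
    rw [le_div_iff₀ this.1]; linarith [this.2]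
  · intro t
    have := (h1 t).ne'
    apply Subtype.ext
    simp only
    field_simp
    ring
  · intro s
    have := s.2.1.ne'
    apply Subtype.ext
    simp only
    rw [add_sub_cancel, div_div_cancel₀ ha.ne']
  · apply Continuous.subtype_mk
    exact Continuous.div continuous_const (by fun_prop) (fun t => (h1 t).ne')
  · apply Continuous.subtype_mk
    exact (Continuous.div continuous_const (by fun_prop) (fun s => s.2.1.ne')).sub continuous_const

lemma ray_Ico (c d : ℝ) (hcd : c < d) : Nonempty (↥(Set.Ici (0:ℝ)) ≃ₜ ↥(Set.Ico c d)) := by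
  obtain ⟨e⟩ := ray_Ioc (d - c) (by linarith)
  refine ⟨e.trans { toFun := fun t => ⟨d - t, ?_, ?_⟩
                    invFun := fun s => ⟨d - s, ?_, ?_⟩
                    left_inv := fun t => by simp
                    right_inv := fun t => by simp
                    continuous_toFun := by fun_prop
                    continuous_invFun := by fun_prop }⟩
  · have := t.2.2; linarith
  · have := t.2.1; linarith
  · have := s.2.2; linarith
  · have := s.2.1; linarith

lemma seg_Icc (c d : ℝ) (hcd : c < d) : Nonempty (↥(Set.Icc (0:ℝ) 1) ≃ₜ ↥(Set.Icc c d)) := 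
  ⟨(iccHomeoI c d hcd).symm⟩

end Bdry

section Homeos

lemma ord_iso {δ' δ r R : ℝ} (h1 : δ' < δ) (h2 : δ < r) (h3 : r < R) :
    ∃ e : ℝ ≃o ℝ, (∀ t, t ≤ δ' → e t = t) ∧ (∀ t, R ≤ t → e t = t) ∧ (∀ t, t ≤ r → e t ≤ δ) := by
  set m1 := (δ - δ') / (r - δ') with hm1
  set m2 := (R - δ) / (R - r) with hm2
  have a1 : 0 < r - δ' := by linarith
  have a2 : 0 < R - r := by linarith
  have m1p : 0 < m1 := div_pos (by linarith) a1
  have m2p : 0 < m2 := div_pos (by linarith) a2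
  have m1l : m1 ≤ 1 := by rw [hm1, div_le_one a1]; linarith
  have m2l : 1 ≤ m2 := by rw [hm2, one_le_div a2]; linarith
  have m1e : m1 * (r - δ') = δ - δ' := div_mul_cancel₀ _ a1.ne'
  have m2e : m2 * (R - r) = R - δ := div_mul_cancel₀ _ a2.ne'
  set g : ℝ → ℝ := fun t => min t (max (δ' + m1 * (t - δ')) (δ + m2 * (t - r))) with hg
  have g1 : ∀ t, t ≤ δ' → g t = t := by
    intro t ht
    apply min_eq_left
    apply le_max_of_le_left
    nlinarith
  have g2 : ∀ t, R ≤ t → g t = t := by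
    intro t ht
    apply min_eq_left
    apply le_max_of_le_right
    nlinarith
  have g3 : ∀ t, t ≤ r → g t ≤ δ := by
    intro t ht
    apply min_le_of_right_le
    apply max_le
    · nlinarith
    · nlinarith
  have gc : Continuous g := by fun_prop
  have gm : StrictMono g := by
    intro x y hxy
    apply min_lt_min hxy
    apply max_lt_max
    · nlinarith
    · nlinarith
  have gs : Function.Surjective g := by
    apply gc.surjective
    · apply Filter.Tendsto.congr' _ Filter.tendsto_id
      filter_upwards [Filter.eventually_ge_atTop R] with t ht
      exact (g2 t ht).symm
    · apply Filter.Tendsto.congr' _ Filter.tendsto_id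
      filter_upwards [Filter.eventually_le_atBot δ'] with t ht
      exact (g1 t ht).symm
  exact ⟨gm.orderIsoOfSurjective g gs, g1, g2, g3⟩

noncomputable def radFun {n : ℕ} (e : ℝ ≃o ℝ) (x : EuclideanSpace ℝ (Fin n)) : EuclideanSpace ℝ (Fin n) :=
  (e ‖x‖ / ‖x‖) • x

lemma radFun_fix {n : ℕ} (e : ℝ ≃o ℝ) (x : EuclideanSpace ℝ (Fin n)) (h : e ‖x‖ = ‖x‖) : radFun e x = x := by
  unfold radFun
  rw [h]
  by_cases hx : x = 0
  · simp [hx]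
  · rw [div_self (norm_ne_zero_iff.2 hx), one_smul]

lemma radFun_norm {n : ℕ} (e : ℝ ≃o ℝ) (h0 : e 0 = 0) (x : EuclideanSpace ℝ (Fin n)) : ‖radFun e x‖ = e ‖x‖ := by
  by_cases hx : x = 0
  · simp [hx, radFun, h0]
  · have hp : 0 < ‖x‖ := norm_pos_iff.2 hx
    have : 0 < e ‖x‖ := by rw [← h0]; exact e.strictMono hp
    rw [radFun, norm_smul, Real.norm_eq_abs, abs_of_pos (by positivity)]
    field_simp

lemma radFun_inv {n : ℕ} (e : ℝ ≃o ℝ) (h0 : e 0 = 0) (x : EuclideanSpace ℝ (Fin n)) : radFun e.symm (radFun e x) = x := by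
  conv_lhs => rw [radFun]
  rw [radFun_norm e h0]
  by_cases hx : x = 0
  · simp [hx, radFun]
  · have hp : 0 < ‖x‖ := norm_pos_iff.2 hx
    have : 0 < e ‖x‖ := by rw [← h0]; exact e.strictMono hp
    rw [radFun, smul_smul, e.symm_apply_apply]
    rw [div_mul_div_comm, mul_comm, div_self (by positivity), one_smul]

lemma radFun_cont {n : ℕ} (e : ℝ ≃o ℝ) {δ : ℝ} (hδ : 0 < δ) (h : ∀ t, t ≤ δ → e t = t) :
    Continuous (radFun e : EuclideanSpace ℝ (Fin n) → EuclideanSpace ℝ (Fin n)) := by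
  rw [continuous_iff_continuousAt]
  intro x
  by_cases hx : x = 0
  · subst hx
    have : (fun x => x) =ᶠ[𝓝 (0 : EuclideanSpace ℝ (Fin n))] radFun e := by
      filter_upwards [Metric.closedBall_mem_nhds (0 : EuclideanSpace ℝ (Fin n)) hδ] with y hy
      exact (radFun_fix e y (h _ (by simpa using hy))).symm
    exact continuousAt_id.congr this
  · unfold radFun
    refine ContinuousAt.smul (ContinuousAt.div ?_ continuousAt_id.norm (norm_ne_zero_iff.2 hx)) continuousAt_id
    exact e.continuous.continuousAt.comp continuousAt_id.norm

lemma radial {n : ℕ} {δ' δ r R : ℝ} (h0 : 0 < δ') (h1 : δ' < δ) (h2 : δ < r) (h3 : r < R) :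
    ∃ sg : EuclideanSpace ℝ (Fin n) ≃ₜ EuclideanSpace ℝ (Fin n), (∀ x, ‖x‖ ≤ δ' → sg x = x) ∧ (∀ x, R ≤ ‖x‖ → sg x = x) ∧
      (∀ x, ‖x‖ ≤ r → ‖sg x‖ ≤ δ) := by
  obtain ⟨e, e1, e2, e3⟩ := ord_iso h1 h2 h3
  have e0 : e 0 = 0 := e1 0 h0.le
  have e0' : e.symm 0 = 0 := by rw [e.symm_apply_eq, e0]
  have e1' : ∀ t, t ≤ δ' → e.symm t = t := fun t ht => by rw [e.symm_apply_eq, e1 t ht]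
  refine ⟨{ toFun := radFun e
            invFun := radFun e.symm
            left_inv := radFun_inv e e0
            right_inv := radFun_inv e.symm e0'
            continuous_toFun := radFun_cont e h0 e1
            continuous_invFun := radFun_cont e.symm h0 e1' }, ?_, ?_, ?_⟩
  · exact fun x hx => radFun_fix e x (e1 _ hx)
  · exact fun x hx => radFun_fix e x (e2 _ hx)
  · intro x hx
    show ‖radFun e x‖ ≤ δ
    rw [radFun_norm e e0]
    exact e3 _ hx

variable {M : Type*} [TopologicalSpace M] [T2Space M] {n : ℕ}

lemma ext_homeo (φ : EuclideanSpace ℝ (Fin n) → M) (hφ : IsOpenEmbedding φ) (R : ℝ)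
    (sg : EuclideanSpace ℝ (Fin n) ≃ₜ EuclideanSpace ℝ (Fin n)) (hsg : ∀ x, R ≤ ‖x‖ → sg x = x) :
    ∃ s : M ≃ₜ M, (∀ x, s (φ x) = φ (sg x)) ∧ ∀ y, y ∉ φ '' Metric.ball 0 R → s y = y := by
  classical
  let F : (EuclideanSpace ℝ (Fin n) ≃ₜ EuclideanSpace ℝ (Fin n)) → M → M := fun sg y =>
    if h : y ∈ range φ then φ (sg h.choose) else y
  have F1 : ∀ sg x, F sg (φ x) = φ (sg x) := by
    intro sg x
    have h : φ x ∈ range φ := ⟨x, rfl⟩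
    simp only [F, h, dif_pos]
    rw [hφ.injective h.choose_spec]
  have F2 : ∀ sg y, y ∉ range φ → F sg y = y := by
    intro sg y hy
    simp only [F, hy, dif_neg, not_false_eq_true]
  have F3 : ∀ sg : EuclideanSpace ℝ (Fin n) ≃ₜ EuclideanSpace ℝ (Fin n), (∀ x, R ≤ ‖x‖ → sg x = x) →
      ∀ y, y ∉ φ '' Metric.ball 0 R → F sg y = y := by
    intro sg hsg y hy
    by_cases h : y ∈ range φ
    · obtain ⟨x, rfl⟩ := h
      rw [F1, hsg]
      by_contra hc
      exact hy ⟨x, by simpa using hc, rfl⟩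
    · exact F2 sg y h
  have Fc : ∀ sg : EuclideanSpace ℝ (Fin n) ≃ₜ EuclideanSpace ℝ (Fin n), (∀ x, R ≤ ‖x‖ → sg x = x) → Continuous (F sg) := by
    intro sg hsg
    rw [continuous_iff_continuousAt]
    intro y
    by_cases h : y ∈ range φ
    · obtain ⟨x, rfl⟩ := h
      rw [← hφ.continuousAt_iff]
      have : F sg ∘ φ = φ ∘ sg := funext (F1 sg)
      rw [this]
      exact (hφ.continuous.comp sg.continuous).continuousAt
    · have hcl : IsClosed (φ '' Metric.closedBall 0 R) := ((isCompact_closedBall _ _).image hφ.continuous).isClosed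
      have hn : (φ '' Metric.closedBall 0 R)ᶜ ∈ 𝓝 y := hcl.isOpen_compl.mem_nhds (fun ⟨x, _, hx⟩ => h ⟨x, hx⟩)
      have : (fun y => y) =ᶠ[𝓝 y] F sg := by
        filter_upwards [hn] with z hz
        exact (F3 sg hsg z (fun hc => hz (image_mono Metric.ball_subset_closedBall hc))).symm
      exact continuousAt_id.congr this
  have Finv : ∀ sg y, F sg.symm (F sg y) = y := by
    intro sg y
    by_cases h : y ∈ range φ
    · obtain ⟨x, rfl⟩ := h
      rw [F1, F1, sg.symm_apply_apply]
    · rw [F2 sg y h, F2 _ y h]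
  have hsg' : ∀ x, R ≤ ‖x‖ → sg.symm x = x := fun x hx => by rw [sg.symm_apply_eq, hsg x hx]
  exact ⟨{ toFun := F sg
           invFun := F sg.symm
           left_inv := Finv sg
           right_inv := by intro y; simpa using Finv sg.symm y
           continuous_toFun := Fc sg hsg
           continuous_invFun := Fc sg.symm hsg' }, F1 sg, F3 sg hsg⟩

lemma squeeze (φ : EuclideanSpace ℝ (Fin n) → M) (hφ : IsOpenEmbedding φ) {δ' δ r R : ℝ}
    (h0 : 0 < δ') (h1 : δ' < δ) (h2 : δ < r) (h3 : r < R) :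
    ∃ s : M ≃ₜ M, (∀ x, ‖x‖ ≤ δ' → s (φ x) = φ x) ∧ (∀ y, y ∉ φ '' Metric.ball 0 R → s y = y) ∧
      (∀ x, ‖x‖ ≤ r → s (φ x) ∈ φ '' Metric.closedBall 0 δ) := by
  obtain ⟨sg, s1, s2, s3⟩ := radial (n := n) h0 h1 h2 h3
  obtain ⟨s, t1, t2⟩ := ext_homeo φ hφ R sg s2
  refine ⟨s, fun x hx => by rw [t1, s1 x hx], t2, fun x hx => ?_⟩
  rw [t1]
  exact ⟨_, by simpa using s3 x hx, rfl⟩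

lemma mem_iff_of_fix {α : Type*} (s : α ≃ α) {W R : Set α} (hWR : W ⊆ R) (h : ∀ y, y ∉ W → s y = y) (x : α) :
    s x ∈ R ↔ x ∈ R := by
  by_cases hx : x ∈ W
  · have : s x ∈ W := by
      by_contra hc
      have := s.injective (h _ hc)
      rw [this] at hc
      exact hc hx
    exact ⟨fun _ => hWR hx, fun _ => hWR this⟩
  · rw [h x hx]

lemma stab_fun {X : Type*} [TopologicalSpace X] (H : ℕ → X ≃ₜ X) (U : ℕ → Set X) (hU : ∀ i, IsOpen (U i))
    (hmono : ∀ i, U i ⊆ U (i+1)) (hs : ∀ i, ∀ x ∈ U i, H (i+1) x = H i x) :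
    ∃ h : X → X, (∀ i, ∀ x ∈ U i, h x = H i x) ∧ ContinuousOn h (⋃ i, U i) := by
  classical
  have hm : Monotone U := monotone_nat_of_le_succ hmono
  have hs' : ∀ i j, i ≤ j → ∀ x ∈ U i, H j x = H i x := by
    intro i j hij
    induction j, hij using Nat.le_induction with
    | base => intro x _; rfl
    | succ j hj ih => intro x hx; rw [hs j x (hm hj hx), ih x hx]
  let h : X → X := fun x => if hx : ∃ i, x ∈ U i then H hx.choose x else x
  have h1 : ∀ i, ∀ x ∈ U i, h x = H i x := by
    intro i x hx
    have hex : ∃ i, x ∈ U i := ⟨i, hx⟩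
    simp only [h, hex, dif_pos]
    rcases le_total i hex.choose with hle | hle
    · exact hs' _ _ hle x hx
    · exact (hs' _ _ hle x hex.choose_spec).symm
  refine ⟨h, h1, ?_⟩
  intro x hx
  obtain ⟨i, hi⟩ := mem_iUnion.1 hx
  apply ContinuousAt.continuousWithinAt
  have : (H i) =ᶠ[𝓝 x] h := by
    filter_upwards [(hU i).mem_nhds hi] with y hy
    exact (h1 i y hy).symm
  exact (H i).continuous.continuousAt.congr this

lemma stab {X : Type*} [TopologicalSpace X] (H : ℕ → X ≃ₜ X) (U : ℕ → Set X) (hU : ∀ i, IsOpen (U i))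
    (hmono : ∀ i, U i ⊆ U (i+1)) (hs : ∀ i, ∀ x ∈ U i, H (i+1) x = H i x)
    (Y Z : Set X) (hY : Y ⊆ ⋃ i, U i) (hZ : ∀ z ∈ Z, ∃ i, (H i).symm z ∈ U i)
    (hYZ : ∀ i, ∀ x ∈ U i, (x ∈ Y ↔ H i x ∈ Z)) : Nonempty (↥Y ≃ₜ ↥Z) := by
  obtain ⟨h, h1, hc⟩ := stab_fun H U hU hmono hs
  obtain ⟨k, k1, kc⟩ := stab_fun (fun i => (H i).symm) (fun i => (H i).symm ⁻¹' (U i))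
    (fun i => (hU i).preimage (H i).symm.continuous)
    (by
      intro i x hx
      have hx' : (H i).symm x ∈ U i := hx
      have e : H (i+1) ((H i).symm x) = x := by rw [hs i _ hx', (H i).apply_symm_apply]
      show (H (i+1)).symm x ∈ U (i+1)
      have : (H (i+1)).symm x = (H i).symm x := by rw [(H (i+1)).symm_apply_eq, e]
      rw [this]; exact hmono i hx')
    (by
      intro i x hx
      have hx' : (H i).symm x ∈ U i := hx
      have e : H (i+1) ((H i).symm x) = x := by rw [hs i _ hx', (H i).apply_symm_apply]
      rw [(H (i+1)).symm_apply_eq, e])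
  have hYm : ∀ x ∈ Y, h x ∈ Z ∧ k (h x) = x := by
    intro x hx
    obtain ⟨i, hi⟩ := mem_iUnion.1 (hY hx)
    rw [h1 i x hi]
    refine ⟨(hYZ i x hi).1 hx, ?_⟩
    rw [k1 i (H i x) (by simpa using hi), (H i).symm_apply_apply]
  have hZm : ∀ z ∈ Z, k z ∈ Y ∧ h (k z) = z := by
    intro z hz
    obtain ⟨i, hi⟩ := hZ z hz
    rw [k1 i z hi]
    refine ⟨(hYZ i _ hi).2 (by simpa using hz), ?_⟩
    rw [h1 i _ hi, (H i).apply_symm_apply]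
  have hZ' : Z ⊆ ⋃ i, (H i).symm ⁻¹' (U i) := fun z hz => mem_iUnion.2 (hZ z hz)
  exact ⟨{ toFun := fun x => ⟨h x, (hYm x x.2).1⟩
           invFun := fun z => ⟨k z, (hZm z z.2).1⟩
           left_inv := fun x => Subtype.ext (hYm x x.2).2
           right_inv := fun z => Subtype.ext (hZm z z.2).2
           continuous_toFun := Continuous.subtype_mk (continuousOn_iff_continuous_domRestrict.1 (hc.mono hY)) _
           continuous_invFun := Continuous.subtype_mk (continuousOn_iff_continuous_domRestrict.1 (kc.mono hZ')) _ }⟩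

end Homeos

section AttrPart
set_option linter.unusedSectionVars false

variable {M : Type*} [TopologicalSpace M] [T2Space M] {n : ℕ}

lemma hpow_succ (G : M ≃ₜ M) (k : ℕ) (x : M) : (G ^ (k+1)) x = (G ^ k) (G x) := by
  rw [pow_succ]; rfl

lemma hpow_succ' (G : M ≃ₜ M) (k : ℕ) (x : M) : (G ^ (k+1)) x = G ((G ^ k) x) := by
  rw [pow_succ']; rfl

lemma hpow_fix (G : M ≃ₜ M) {p : M} (h : G p = p) (k : ℕ) : (G ^ k) p = p := by
  induction k with
  | zero => rfl
  | succ k ih => rw [hpow_succ, h, ih]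

lemma small_ball (φ : EuclideanSpace ℝ (Fin n) → M) (hφ : IsOpenEmbedding φ) (h : M ≃ₜ M)
    {V : Set M} (hV : V ∈ 𝓝 (h (φ 0))) (c : ℝ) (hc : 0 < c) :
    ∃ δ, 0 < δ ∧ δ < c ∧ ∀ x, ‖x‖ ≤ δ → h (φ x) ∈ V := by
  have hcont : ContinuousAt (fun x => h (φ x)) 0 := (h.continuous.comp hφ.continuous).continuousAt
  obtain ⟨ε, hε, hb⟩ := Metric.mem_nhds_iff.1 (hcont hV)
  refine ⟨min ε c / 2, by positivity, ?_, ?_⟩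
  · have := min_le_right ε c
    have : 0 < min ε c := by positivity
    linarith [min_le_right ε c]
  · intro x hx
    apply hb
    have : 0 < min ε c := by positivity
    have := min_le_left ε c
    simp only [Metric.mem_ball, dist_zero_right]
    linarith

lemma attr_step (φ : EuclideanSpace ℝ (Fin n) → M) (hφ : IsOpenEmbedding φ) (G : M ≃ₜ M)
    (hG : G (φ 0) = φ 0) {a b : ℝ} (ha : 0 < a) (hab : a < b)
    (hb : ∀ x, ‖x‖ ≤ b → G (φ x) ∈ φ '' Metric.ball 0 a) (i : ℕ) (h : M ≃ₜ M) (hp : h (φ 0) = φ 0) :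
    ∃ h' : M ≃ₜ M, h' (φ 0) = φ 0 ∧ (∀ x, x ∉ ⇑(G ^ i) '' (φ '' Metric.closedBall 0 a) → h' x = h x) ∧
      ∀ x ∈ ⇑(G ^ (i+1)) '' (φ '' Metric.closedBall 0 a), h' x ∈ φ '' Metric.closedBall 0 (1/((i:ℝ)+1)) := by
  have hV : φ '' Metric.ball 0 (1/((i:ℝ)+1)) ∈ 𝓝 (((G^(i+1)).trans h) (φ 0)) := by
    have : ((G^(i+1)).trans h) (φ 0) = φ 0 := by
      show h ((G^(i+1)) (φ 0)) = _
      rw [hpow_fix G hG, hp]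
    rw [this]
    exact (hφ.isOpenMap _ Metric.isOpen_ball).mem_nhds ⟨0, by simp; positivity, rfl⟩
  obtain ⟨δ, d0, d1, d2⟩ := small_ball φ hφ _ hV a ha
  obtain ⟨s, s1, s2, s3⟩ := squeeze φ hφ (half_pos d0) (half_lt_self d0) d1 hab
  refine ⟨((G^(i+1)).symm.trans (s.trans (G^(i+1)))).trans h, ?_, ?_, ?_⟩
  · show h ((G^(i+1)) (s ((G^(i+1)).symm (φ 0)))) = φ 0
    have : (G^(i+1)).symm (φ 0) = φ 0 := by rw [(G^(i+1)).symm_apply_eq, hpow_fix G hG]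
    rw [this, s1 0 (by simp; positivity), hpow_fix G hG, hp]
  · intro x hx
    show h ((G^(i+1)) (s ((G^(i+1)).symm x))) = h x
    rw [s2, (G^(i+1)).apply_symm_apply]
    rintro ⟨y, hy, he⟩
    apply hx
    obtain ⟨z, hz, hze⟩ := hb y (by simp at hy; exact hy.le)
    refine ⟨φ z, ⟨z, Metric.ball_subset_closedBall hz, rfl⟩, ?_⟩
    rw [hze, ← hpow_succ, he, (G^(i+1)).apply_symm_apply]
  · rintro _ ⟨_, ⟨y, hy, rfl⟩, rfl⟩
    show h ((G^(i+1)) (s ((G^(i+1)).symm ((G^(i+1)) (φ y))))) ∈ _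
    rw [(G^(i+1)).symm_apply_apply]
    obtain ⟨z, hz, hze⟩ := s3 y (by simpa using hy)
    rw [← hze]
    exact image_mono Metric.ball_subset_closedBall (d2 z (by simpa using hz))

lemma attr_part (φ : EuclideanSpace ℝ (Fin n) → M) (hφ : IsOpenEmbedding φ) (G : M ≃ₜ M)
    (hG : G (φ 0) = φ 0) {a b : ℝ} (ha : 0 < a) (hab : a < b)
    (hb : ∀ x, ‖x‖ ≤ b → G (φ x) ∈ φ '' Metric.ball 0 a) :
    Nonempty (↥(φ '' Metric.closedBall 0 a \ ⋂ j : ℕ, ⇑(G ^ j) '' (φ '' Metric.closedBall 0 a)) ≃ₜ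
      ↥(φ '' Metric.closedBall 0 a \ {φ 0})) := by
  set D := φ '' Metric.closedBall 0 a with hD
  choose! st t1 t2 t3 using attr_step φ hφ G hG ha hab hb
  let H : ℕ → M ≃ₜ M := fun i => Nat.rec (1 : M ≃ₜ M) (fun i h => st i h) i
  have H0 : H 0 = 1 := rfl
  have Hs : ∀ i, H (i+1) = st i (H i) := fun i => rfl
  have Hp : ∀ i, H i (φ 0) = φ 0 := by
    intro i
    induction i with
    | zero => rfl
    | succ i ih => rw [Hs]; exact t1 i _ ih
  have hGD : ∀ i, ⇑(G ^ (i+1)) '' D ⊆ ⇑(G ^ i) '' D := by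
    rintro i _ ⟨_, ⟨y, hy, rfl⟩, rfl⟩
    rw [hpow_succ]
    apply mem_image_of_mem
    exact image_mono Metric.ball_subset_closedBall (hb y (by simp at hy; linarith))
  have hGD0 : ∀ i, ⇑(G ^ i) '' D ⊆ D := by
    intro i
    induction i with
    | zero => rw [pow_zero]; rintro _ ⟨y, hy, rfl⟩; exact hy
    | succ i ih => exact (hGD i).trans ih
  have hst : ∀ i, ∀ x, x ∉ ⇑(G ^ i) '' D → H (i+1) x = H i x := by
    intro i x hx; rw [Hs]; exact t2 i _ (Hp i) x hx
  have hid : ∀ i, ∀ x, x ∉ D → H i x = x := by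
    intro i
    induction i with
    | zero => intro x _; rfl
    | succ i ih => intro x hx; rw [hst i x (fun hc => hx (hGD0 i hc)), ih x hx]
  have hHD : ∀ i x, H i x ∈ D ↔ x ∈ D := fun i x => mem_iff_of_fix (H i).toEquiv subset_rfl (hid i) x
  have hpD : φ 0 ∈ D := ⟨0, by simp; exact ha.le, rfl⟩
  have hDc : IsCompact D := (isCompact_closedBall _ _).image hφ.continuous
  apply stab H (fun i => (⇑(G ^ i) '' D)ᶜ) (fun i => (hDc.image (G^i).continuous).isClosed.isOpen_compl)
    (fun i => compl_subset_compl.2 (hGD i)) hst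
  · rintro x ⟨_, hx⟩
    simpa using hx
  · rintro z ⟨⟨y, hy, rfl⟩, hz⟩
    have hy0 : y ≠ 0 := by rintro rfl; exact hz rfl
    obtain ⟨i, hi⟩ := exists_nat_one_div_lt (norm_pos_iff.2 hy0)
    refine ⟨i+1, fun hc => ?_⟩
    have := t3 i (H i) (Hp i) _ hc
    rw [← Hs, (H (i+1)).apply_symm_apply] at this
    obtain ⟨w, hw, hwe⟩ := this
    rw [hφ.injective hwe] at hw
    simp at hw
    simp at hi
    linarith
  · intro i x hx
    constructor
    · rintro ⟨h1, h2⟩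
      refine ⟨(hHD i x).2 h1, fun hc => hx ?_⟩
      have : x = φ 0 := (H i).injective (by rw [Hp i]; exact hc)
      rw [this]
      exact ⟨φ 0, hpD, hpow_fix G hG i⟩
    · rintro ⟨h1, _⟩
      exact ⟨(hHD i x).1 h1, fun hc => hx (mem_iInter.1 hc i)⟩

end AttrPart

section RepPart
set_option linter.unusedSectionVars false

variable {M : Type*} [TopologicalSpace M] [T2Space M] {n : ℕ}

def repR (φ : EuclideanSpace ℝ (Fin n) → M) (G : M ≃ₜ M) (c : ℝ) : Set M :=
  ⋃ j : ℕ, ⇑(G ^ j) '' (φ '' Metric.ball 0 c)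

lemma rep_sub (φ : EuclideanSpace ℝ (Fin n) → M) (G : M ≃ₜ M) {c d : ℝ}
    (hd : ∀ x, ‖x‖ ≤ d → G.symm (φ x) ∈ φ '' Metric.ball 0 c) (k : ℕ) (x : EuclideanSpace ℝ (Fin n))
    (hx : ‖x‖ ≤ d) : (G^k) (φ x) ∈ ⇑(G ^ (k+1)) '' (φ '' Metric.ball 0 c) := by
  refine ⟨_, hd x hx, ?_⟩
  rw [hpow_succ, G.apply_symm_apply]

lemma rep_sub' (φ : EuclideanSpace ℝ (Fin n) → M) (G : M ≃ₜ M) {c d : ℝ}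
    (hd : ∀ x, ‖x‖ ≤ d → G.symm (φ x) ∈ φ '' Metric.ball 0 c) (k : ℕ) (x : EuclideanSpace ℝ (Fin n))
    (hx : ‖x‖ ≤ d) : (G^k) (φ x) ∈ repR φ G c :=
  mem_iUnion.2 ⟨k+1, rep_sub φ G hd k x hx⟩

lemma rep_engulf (φ : EuclideanSpace ℝ (Fin n) → M) (hφ : IsOpenEmbedding φ) (G : M ≃ₜ M)
    (hG : G (φ 0) = φ 0) {c d : ℝ} (hc : 0 < c) (hcd : c < d)
    (hd : ∀ x, ‖x‖ ≤ d → G.symm (φ x) ∈ φ '' Metric.ball 0 c)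
    {a b : ℝ} (ha : 0 < a) (hab : a < b) (hbd : b ≤ d) (Q : Set M) (hQ : IsCompact Q) (hQR : Q ⊆ repR φ G c) :
    ∃ g : M ≃ₜ M, (∀ x, ‖x‖ ≤ a → g (φ x) = φ x) ∧ (∀ x, g x ∈ repR φ G c ↔ x ∈ repR φ G c) ∧
      ∀ y ∈ Q, g.symm y ∈ φ '' Metric.ball 0 b := by
  have hR0 : ∀ x, ‖x‖ ≤ d → φ x ∈ repR φ G c := fun x hx => by simpa using rep_sub' φ G hd 0 x hx
  obtain ⟨k, hk⟩ : ∃ k : ℕ, Q ∪ φ '' Metric.closedBall 0 b ⊆ ⇑(G ^ k) '' (φ '' Metric.ball 0 c) := by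
    apply IsCompact.elim_directed_cover (hQ.union ((isCompact_closedBall _ _).image hφ.continuous))
    · exact fun k => (G^k).isOpenMap _ (hφ.isOpenMap _ Metric.isOpen_ball)
    · apply union_subset hQR
      rintro _ ⟨x, hx, rfl⟩
      exact hR0 x (by simp at hx; linarith)
    · apply Monotone.directed_le
      apply monotone_nat_of_le_succ
      rintro k _ ⟨_, ⟨x, hx, rfl⟩, rfl⟩
      exact rep_sub φ G hd k x (by simp at hx; linarith)
  have hb : 0 < b := ha.trans hab
  have nb : ∀ r : ℝ, 0 < r → φ '' Metric.ball 0 r ∈ 𝓝 (φ 0) := fun r hr =>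
    (hφ.isOpenMap _ Metric.isOpen_ball).mem_nhds ⟨0, by simpa using hr, rfl⟩
  have hGk : (G^k) (φ 0) = φ 0 := hpow_fix G hG k
  have hGk' : (G^k).symm (φ 0) = φ 0 := by rw [(G^k).symm_apply_eq, hGk]
  obtain ⟨δ, d0, d1, d2⟩ := small_ball φ hφ (G^k) (V := φ '' Metric.ball 0 b) (by rw [hGk]; exact nb b hb) c hc
  obtain ⟨s, s1, s2, s3⟩ := squeeze φ hφ (half_pos d0) (half_lt_self d0) d1 hcd
  obtain ⟨ε, e0, e1, e2⟩ := small_ball φ hφ (G^k).symm (V := φ '' Metric.ball 0 (δ/2))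
    (by rw [hGk']; exact nb _ (half_pos d0)) a ha
  obtain ⟨t, t1, t2, t3⟩ := squeeze φ hφ (half_pos e0) (half_lt_self e0) e1 hab
  set s' : M ≃ₜ M := (G^k).symm.trans (s.trans (G^k)) with hs'
  have s'a : ∀ x, s' x = (G^k) (s ((G^k).symm x)) := fun x => rfl
  have hsR : ∀ x, s' x ∈ repR φ G c ↔ x ∈ repR φ G c := by
    apply mem_iff_of_fix s'.toEquiv (W := ⇑(G^k) '' (φ '' Metric.ball 0 d))
    · rintro _ ⟨_, ⟨x, hx, rfl⟩, rfl⟩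
      exact rep_sub' φ G hd k x (by simp at hx; exact hx.le)
    · intro y hy
      show s' y = y
      rw [s'a, s2, (G^k).apply_symm_apply]
      intro hc
      exact hy ⟨_, hc, (G^k).apply_symm_apply y⟩
  have htR : ∀ x, t x ∈ repR φ G c ↔ x ∈ repR φ G c := by
    apply mem_iff_of_fix t.toEquiv (W := φ '' Metric.ball 0 b) _ t2
    rintro _ ⟨x, hx, rfl⟩
    exact hR0 x (by simp at hx; linarith)
  refine ⟨t.trans (s'.symm.trans t.symm), ?_, ?_, ?_⟩
  · intro x hx
    show t.symm (s'.symm (t (φ x))) = φ x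
    rw [t.symm_apply_eq, s'.symm_apply_eq, s'a]
    obtain ⟨w, hw, hwe⟩ := t3 x hx
    obtain ⟨v, hv, hve⟩ := e2 w (by simpa using hw)
    rw [← hwe, ← hve, s1 v (by simp at hv; exact hv.le), hve, (G^k).apply_symm_apply]
  · intro x
    show t.symm (s'.symm (t x)) ∈ _ ↔ _
    rw [← htR, t.apply_symm_apply, ← hsR, s'.apply_symm_apply, htR]
  · intro y hy
    show t.symm (s' (t y)) ∈ _
    have h1 : t y ∈ ⇑(G ^ k) '' (φ '' Metric.ball 0 c) := by
      apply hk
      refine (mem_iff_of_fix t.toEquiv (W := φ '' Metric.ball 0 b) ?_ t2 y).2 (Or.inl hy)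
      exact (image_mono Metric.ball_subset_closedBall).trans subset_union_right
    obtain ⟨_, ⟨w, hw, rfl⟩, hwe⟩ := h1
    have h2 : s' (t y) ∈ φ '' Metric.ball 0 b := by
      rw [← hwe, s'a, (G^k).symm_apply_apply]
      obtain ⟨v, hv, hve⟩ := s3 w (by simp at hw; exact hw.le)
      rw [← hve]
      exact d2 v (by simpa using hv)
    have := mem_iff_of_fix t.toEquiv (W := φ '' Metric.ball 0 b) subset_rfl t2 (t.symm (s' (t y)))
    apply this.1
    show t (t.symm (s' (t y))) ∈ _
    rw [t.apply_symm_apply]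
    exact h2

noncomputable def aseq (c d : ℝ) (i : ℕ) : ℝ := d - (d - c) / ((i:ℝ) + 1)

lemma aseq_lt {c d : ℝ} (h : c < d) (i : ℕ) : aseq c d i < aseq c d (i+1) := by
  unfold aseq
  have : (d - c) / (((i+1 : ℕ):ℝ) + 1) < (d - c) / ((i:ℝ) + 1) := by
    apply div_lt_div_of_pos_left (by linarith) (by positivity)
    push_cast; linarith
  linarith

lemma aseq_lt_d {c d : ℝ} (h : c < d) (i : ℕ) : aseq c d i < d := by
  unfold aseq
  have : 0 < (d - c) / ((i:ℝ) + 1) := div_pos (by linarith) (by positivity)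
  linarith

lemma aseq_zero (c d : ℝ) : aseq c d 0 = c := by simp [aseq]

lemma aseq_ge {c d : ℝ} (h : c < d) (i : ℕ) : c ≤ aseq c d i := by
  have hm : Monotone (aseq c d) := monotone_nat_of_le_succ (fun i => (aseq_lt h i).le)
  have := hm (Nat.zero_le i)
  rwa [aseq_zero] at this

lemma aseq_ex {c d t : ℝ} (h : c < d) (ht : t < d) : ∃ i, t < aseq c d i := by
  obtain ⟨i, hi⟩ := exists_nat_one_div_lt (show 0 < (d - t) / (d - c) from div_pos (by linarith) (by linarith))
  refine ⟨i, ?_⟩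
  have hdc : 0 < d - c := by linarith
  rw [lt_div_iff₀ hdc] at hi
  have : (d - c) / ((i:ℝ) + 1) = 1 / ((i:ℝ)+1) * (d - c) := by ring
  unfold aseq
  rw [this]
  linarith

lemma rep_step (φ : EuclideanSpace ℝ (Fin n) → M) (hφ : IsOpenEmbedding φ) (G : M ≃ₜ M)
    (hG : G (φ 0) = φ 0) {c d : ℝ} (hc : 0 < c) (hcd : c < d)
    (hd : ∀ x, ‖x‖ ≤ d → G.symm (φ x) ∈ φ '' Metric.ball 0 c) (i : ℕ) (h : M ≃ₜ M)
    (hh : ∀ x, h x ∈ repR φ G c ↔ x ∈ repR φ G c) :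
    ∃ h' : M ≃ₜ M, (∀ x, h' x ∈ repR φ G c ↔ x ∈ repR φ G c) ∧
      (∀ x ∈ φ '' Metric.ball 0 (aseq c d i), h' x = h x) ∧
      ∀ z ∈ ⇑(G ^ i) '' (φ '' Metric.closedBall 0 c), h'.symm z ∈ φ '' Metric.ball 0 (aseq c d (i+1)) := by
  obtain ⟨g, g1, g2, g3⟩ := rep_engulf φ hφ G hG hc hcd hd (hc.trans_le (aseq_ge hcd i)) (aseq_lt hcd i)
    (aseq_lt_d hcd (i+1)).le (⇑h.symm '' (⇑(G ^ i) '' (φ '' Metric.closedBall 0 c)))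
    ((((isCompact_closedBall _ _).image hφ.continuous).image (G^i).continuous).image h.symm.continuous)
    (by
      rintro _ ⟨_, ⟨_, ⟨x, hx, rfl⟩, rfl⟩, rfl⟩
      rw [← hh, h.apply_symm_apply]
      exact rep_sub' φ G hd i x (by simp at hx; linarith))
  refine ⟨g.trans h, ?_, ?_, ?_⟩
  · intro x
    show h (g x) ∈ _ ↔ _
    rw [hh, g2]
  · rintro _ ⟨x, hx, rfl⟩
    show h (g (φ x)) = h (φ x)
    rw [g1 x (by simp at hx; exact hx.le)]
  · intro z hz
    exact g3 (h.symm z) ⟨z, hz, rfl⟩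

lemma rep_part (φ : EuclideanSpace ℝ (Fin n) → M) (hφ : IsOpenEmbedding φ) (G : M ≃ₜ M)
    (hG : G (φ 0) = φ 0) {c d : ℝ} (hc : 0 < c) (hcd : c < d)
    (hd : ∀ x, ‖x‖ ≤ d → G.symm (φ x) ∈ φ '' Metric.ball 0 c) :
    Nonempty (↥(φ '' {x | ‖x‖ ∈ Ico c d}) ≃ₜ ↥(repR φ G c \ φ '' Metric.ball 0 c)) := by
  choose! st t1 t2 t3 using rep_step φ hφ G hG hc hcd hd
  let H : ℕ → M ≃ₜ M := fun i => Nat.rec (1 : M ≃ₜ M) (fun i h => st i h) i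
  have Hs : ∀ i, H (i+1) = st i (H i) := fun i => rfl
  have HR : ∀ i x, H i x ∈ repR φ G c ↔ x ∈ repR φ G c := by
    intro i
    induction i with
    | zero => intro x; rfl
    | succ i ih => rw [Hs]; exact t1 i _ ih
  have hst : ∀ i, ∀ x ∈ φ '' Metric.ball 0 (aseq c d i), H (i+1) x = H i x := by
    intro i; rw [Hs]; exact t2 i _ (HR i)
  have hid : ∀ i x, ‖x‖ < c → H i (φ x) = φ x := by
    intro i x hx
    induction i with
    | zero => rfl
    | succ i ih => rw [hst i _ ⟨x, by simp; exact hx.trans_le (aseq_ge hcd i), rfl⟩, ih]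
  have hR0 : ∀ x, ‖x‖ ≤ d → φ x ∈ repR φ G c := fun x hx => by simpa using rep_sub' φ G hd 0 x hx
  apply stab H (fun i => φ '' Metric.ball 0 (aseq c d i)) (fun i => hφ.isOpenMap _ Metric.isOpen_ball)
    (fun i => image_mono (Metric.ball_subset_ball (aseq_lt hcd i).le)) hst
  · rintro _ ⟨x, hx, rfl⟩
    obtain ⟨i, hi⟩ := aseq_ex hcd hx.2
    exact mem_iUnion.2 ⟨i, x, by simpa using hi, rfl⟩
  · rintro z ⟨hz, _⟩
    obtain ⟨i, hi⟩ := mem_iUnion.1 hz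
    refine ⟨i+1, ?_⟩
    rw [Hs]
    exact t3 i _ (HR i) z (image_mono (image_mono Metric.ball_subset_closedBall) hi)
  · rintro i _ ⟨x, hx, rfl⟩
    have hx' : ‖x‖ < aseq c d i := by simpa using hx
    have hxd : ‖x‖ < d := hx'.trans (aseq_lt_d hcd i)
    have hHi : H i (φ x) ∈ repR φ G c := (HR i _).2 (hR0 x hxd.le)
    constructor
    · rintro ⟨y, hy, hye⟩
      refine ⟨hHi, ?_⟩
      rintro ⟨u, hu, hue⟩
      have hu' : ‖u‖ < c := by simpa using hu
      rw [← hid i u hu'] at hue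
      have h1 := hφ.injective ((H i).injective hue)
      have h2 := hφ.injective hye
      rw [h2, ← h1] at hy
      exact absurd hy.1 (not_le.2 hu')
    · rintro ⟨_, h2⟩
      refine ⟨x, ⟨?_, hxd⟩, rfl⟩
      by_contra hlt
      push Not at hlt
      exact h2 ⟨x, by simpa using hlt, (hid i x hlt).symm⟩

end RepPart

section Dyn
set_option linter.unusedSectionVars false

variable {M : Type*} [TopologicalSpace M] [T2Space M] {n : ℕ}

lemma hpow_iter (G : M ≃ₜ M) (k : ℕ) : ⇑(G ^ k) = (⇑G)^[k] := by
  induction k with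
  | zero => rfl
  | succ k ih => funext x; rw [hpow_succ, ih]; rfl

lemma hpow_add (G : M ≃ₜ M) (j k : ℕ) (x : M) : (G ^ (j + k)) x = (G ^ j) ((G ^ k) x) := by
  rw [pow_add]; rfl

lemma hpow_symm (G : M ≃ₜ M) (k : ℕ) (x : M) : (G.symm ^ k) ((G ^ k) x) = x := by
  induction k generalizing x with
  | zero => rfl
  | succ k ih => rw [hpow_succ, hpow_succ', G.symm_apply_apply, ih]

lemma omega_fix (g : M ≃ₜ M) (p : M) (U : Set M) (h : {p} = omegaSet g U) : g p = p := by
  have hp : p ∈ omegaSet g U := by rw [← h]; rfl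
  have : g p ∈ omegaSet g U := by
    simp only [omegaSet, mem_iInter] at hp ⊢
    intro m hm
    have h1 := image_closure_subset_closure_image g.continuous (mem_image_of_mem g (hp m hm))
    refine closure_mono ?_ h1
    rintro _ ⟨y, hy, rfl⟩
    simp only [mem_iUnion] at hy ⊢
    obtain ⟨k, hk, z, hz, rfl⟩ := hy
    exact ⟨k+1, by omega, z, hz, Function.iterate_succ_apply' _ _ _⟩
  rw [← h] at this
  exact this

lemma attr_unif (φ : EuclideanSpace ℝ (Fin n) → M) (hφ : IsOpenEmbedding φ) (g : M ≃ₜ M)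
    (hg : g (φ 0) = φ 0) (h : IsAttractor g {φ 0}) :
    ∃ ρ, 0 < ρ ∧ ∀ r, 0 < r → ∃ n0 : ℕ, ∀ k, n0 ≤ k → ∀ x, ‖x‖ < ρ → (g ^ k) (φ x) ∈ φ '' Metric.ball 0 r := by
  obtain ⟨_, U, hU, hUo⟩ := h
  rw [nhdsSet_singleton] at hU
  obtain ⟨ρ, hρ, hb⟩ := Metric.mem_nhds_iff.1 (hφ.continuous.continuousAt hU)
  refine ⟨ρ, hρ, fun r hr => ?_⟩
  have hcomp : IsCompact (φ '' Metric.sphere 0 r) := (isCompact_sphere _ _).image hφ.continuous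
  obtain ⟨m, hm⟩ := hcomp.elim_directed_family_closed
    (fun m : ℕ => closure (⋃ (k : ℕ) (_ : m + 1 ≤ k), (⇑g)^[k] '' U)) (fun m => isClosed_closure)
    (by
      rw [eq_empty_iff_forall_notMem]
      rintro _ ⟨⟨x, hx, rfl⟩, hx2⟩
      have : φ x ∈ omegaSet g U := by
        simp only [omegaSet, mem_iInter] at hx2 ⊢
        intro m hm
        have := hx2 (m - 1)
        rwa [Nat.sub_add_cancel hm] at this
      rw [← hUo] at this
      have hx0 : x = 0 := hφ.injective this
      rw [hx0] at hx
      simp at hx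
      exact hr.ne hx)
    (by
      apply Antitone.directed_ge
      intro i j hij
      apply closure_mono
      apply iUnion_mono
      intro k
      apply iUnion_subset
      intro hk
      exact subset_iUnion_of_subset (by omega) subset_rfl)
  refine ⟨m + 1, fun k hk => ?_⟩
  have hconn : IsPreconnected ((fun x => (g ^ k) (φ x)) '' Metric.ball 0 ρ) :=
    (convex_ball (0 : EuclideanSpace ℝ (Fin n)) ρ).isPreconnected.image _ ((g^k).continuous.comp hφ.continuous).continuousOn
  have hne : ((fun x => (g ^ k) (φ x)) '' Metric.ball 0 ρ ∩ φ '' Metric.ball 0 r).Nonempty :=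
    ⟨φ 0, ⟨0, by simpa using hρ, hpow_fix g hg k⟩, ⟨0, by simpa using hr, rfl⟩⟩
  have hsub := hconn.subset_left_of_subset_union (hφ.isOpenMap _ (Metric.isOpen_ball (x := 0) (ε := r)))
    (((isCompact_closedBall (0 : EuclideanSpace ℝ (Fin n)) r).image hφ.continuous).isClosed.isOpen_compl)
    (by
      rw [Set.disjoint_left]
      intro x hx hx'
      exact hx' (image_mono Metric.ball_subset_closedBall hx))
    (by
      rintro _ ⟨x, hx, rfl⟩
      by_contra hc
      simp only [mem_union, not_or, mem_compl_iff, not_not] at hc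
      obtain ⟨hc1, y, hy, hye⟩ := hc
      have hyr : y ∈ Metric.sphere (0 : EuclideanSpace ℝ (Fin n)) r := by
        by_contra hys
        apply hc1
        rw [← hye]
        refine ⟨y, ?_, rfl⟩
        simp at hy hys ⊢
        exact lt_of_le_of_ne hy hys
      have : φ y ∈ φ '' Metric.sphere 0 r ∩ closure (⋃ (k : ℕ) (_ : m + 1 ≤ k), (⇑g)^[k] '' U) := by
        refine ⟨⟨y, hyr, rfl⟩, subset_closure ?_⟩
        simp only [mem_iUnion]
        refine ⟨k, hk, φ x, hb hx, ?_⟩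
        rw [hye, hpow_iter]
      rw [hm] at this
      exact this)
    hne
  intro x hx
  exact hsub ⟨x, by simpa using hx, rfl⟩

lemma chart (hM : LocallyEuclidean n M) (p : M) :
    ∃ φ : EuclideanSpace ℝ (Fin n) → M, IsOpenEmbedding φ ∧ φ 0 = p := by
  obtain ⟨V, hV, hpV, U, hU, ⟨e⟩⟩ := hM p
  obtain ⟨ε, hε, hb⟩ := Metric.isOpen_iff.1 hU _ (e ⟨p, hpV⟩).2
  set x0 : EuclideanSpace ℝ (Fin n) := (e ⟨p, hpV⟩ : EuclideanSpace ℝ (Fin n)) with hx0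
  let u := OpenPartialHomeomorph.univBall x0 ε
  have hu : IsOpenEmbedding u := u.isOpenEmbedding (OpenPartialHomeomorph.univBall_source x0 ε)
  have huU : ∀ x, u x ∈ U := by
    intro x
    apply hb
    rw [← OpenPartialHomeomorph.univBall_target x0 hε]
    exact u.map_source (by rw [OpenPartialHomeomorph.univBall_source]; trivial)
  let v : EuclideanSpace ℝ (Fin n) → U := fun x => ⟨u x, huU x⟩
  have hv : IsOpenEmbedding v := IsOpenEmbedding.of_comp v hU.isOpenEmbedding_subtypeVal hu
  refine ⟨fun x => (e.symm (v x) : M), hV.isOpenEmbedding_subtypeVal.comp (e.symm.isOpenEmbedding.comp hv), ?_⟩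
  have : v 0 = e ⟨p, hpV⟩ := Subtype.ext (OpenPartialHomeomorph.univBall_apply_zero x0 ε)
  show ((e.symm (v 0) : V) : M) = p
  rw [this, e.symm_apply_apply]

lemma fam_cont (f : unitInterval → M ≃ₜ M) (hf : ContinuousFamily f) (k : ℕ) :
    Continuous (fun q : unitInterval × M => (f q.1 ^ k) q.2) := by
  induction k with
  | zero => exact continuous_snd
  | succ k ih =>
    simp only [hpow_succ]
    exact ih.comp (continuous_fst.prodMk hf.1)

lemma persist (f : unitInterval → M ≃ₜ M) (hf : ContinuousFamily f) (k : ℕ) (Q W : Set M) (hQ : IsCompact Q)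
    (hW : IsOpen W) (h : ∀ x ∈ Q, (f 0 ^ k) x ∈ W) : ∀ᶠ l in 𝓝 (0 : unitInterval), ∀ x ∈ Q, (f l ^ k) x ∈ W := by
  apply hQ.eventually_forall_of_forall_eventually
  intro x hx
  exact (fam_cont f hf k).continuousAt (hW.mem_nhds (h x hx))

lemma ev_small {P : unitInterval → Prop} (h : ∀ᶠ l in 𝓝 (0 : unitInterval), P l) :
    ∃ l₀ : ℝ, 0 < l₀ ∧ ∀ l : unitInterval, (l : ℝ) < l₀ → P l := by
  obtain ⟨ε, hε, hb⟩ := Metric.eventually_nhds_iff.1 h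
  refine ⟨ε, hε, fun l hl => hb ?_⟩
  rw [Subtype.dist_eq]
  simp [abs_of_nonneg l.2.1, hl]

lemma semi (g : M ≃ₜ M) (P Q : Set M) (hQP : Q ⊆ P) (m : ℕ) (hm : 1 ≤ m)
    (h : ∀ k, m ≤ k → k < 2 * m → ∀ x ∈ P, (g ^ k) x ∈ Q) : ∀ k, m ≤ k → ∀ x ∈ P, (g ^ k) x ∈ Q := by
  intro k
  induction k using Nat.strong_induction_on with
  | _ k ih =>
    intro hk x hx
    by_cases hlt : k < 2 * m
    · exact h k hk hlt x hx
    · have := hpow_add g (k - m) m x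
      rw [Nat.sub_add_cancel hk] at this
      rw [this]
      exact ih (k - m) (by omega) (by omega) _ (hQP (h m le_rfl (by omega) x hx))

lemma trap (g : M ≃ₜ M) (C : Set M) (hC : IsCompact C) (N : ℕ) (hN : 1 ≤ N)
    (h : ∀ k, N ≤ k → ∀ x ∈ C, (g ^ k) x ∈ interior C) :
    IsAttractor g (⋂ j : ℕ, ⇑((g ^ N) ^ j) '' C) ∧ (⋂ j : ℕ, ⇑((g ^ N) ^ j) '' C) ⊆ interior C ∧
      ∀ k, (⋂ j : ℕ, ⇑((g ^ N) ^ j) '' C) ⊆ ⇑(g ^ k) '' C := by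
  have hint : (⋂ j : ℕ, ⇑((g ^ N) ^ j) '' C) ⊆ interior C := by
    intro x hx
    obtain ⟨y, hy, rfl⟩ := mem_iInter.1 hx 1
    rw [pow_one]
    exact h N le_rfl y hy
  have hcl : ∀ k, IsClosed (⇑(g ^ k) '' C) := fun k => (hC.image (g^k).continuous).isClosed
  have hcl' : IsClosed (⋂ j : ℕ, ⇑((g ^ N) ^ j) '' C) := isClosed_iInter fun j => by rw [← pow_mul]; exact hcl _
  have hAC : (⋂ j : ℕ, ⇑((g ^ N) ^ j) '' C) ⊆ C := hint.trans interior_subset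
  have hsub : ∀ j k, j + N ≤ k → ⇑(g ^ k) '' C ⊆ ⇑(g ^ j) '' C := by
    rintro j k hk _ ⟨x, hx, rfl⟩
    have := hpow_add g j (k - j) x
    rw [Nat.add_sub_cancel' (by omega)] at this
    rw [this]
    exact mem_image_of_mem _ (interior_subset (h (k - j) (by omega) x hx))
  refine ⟨⟨hC.of_isClosed_subset hcl' hAC, C, ?_, ?_⟩, hint, ?_⟩
  · exact Filter.mem_of_superset (isOpen_interior.mem_nhdsSet.2 hint) interior_subset
  · apply Subset.antisymm
    · intro x hx
      simp only [omegaSet, mem_iInter]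
      intro m hm
      apply subset_closure
      simp only [mem_iUnion]
      refine ⟨N * m, Nat.le_mul_of_pos_left m (by omega), ?_⟩
      rw [← hpow_iter, pow_mul]
      exact mem_iInter.1 hx m
    · intro x hx
      rw [mem_iInter]
      intro j
      simp only [omegaSet, mem_iInter] at hx
      have := hx (N * j + N) (by omega)
      rw [← pow_mul, ← (hcl (N * j)).closure_eq]
      refine closure_mono ?_ this
      apply iUnion_subset
      intro k
      apply iUnion_subset
      intro hk
      rw [← hpow_iter]
      exact hsub _ _ hk
  · intro k x hx
    have := mem_iInter.1 hx (k+1)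
    rw [← pow_mul] at this
    refine hsub k _ ?_ this
    nlinarith

lemma split_sum (Y P Q O₁ O₂ : Set M) (hP : P = Y ∩ O₁) (hQ : Q = Y ∩ O₂) (hY : Y ⊆ P ∪ Q)
    (hd : Disjoint P Q) (h1 : IsOpen O₁) (h2 : IsOpen O₂) : Nonempty (↥Y ≃ₜ ↥P ⊕ ↥Q) := by
  have hPY : P ⊆ Y := by rw [hP]; exact inter_subset_left
  have hQY : Q ⊆ Y := by rw [hQ]; exact inter_subset_left
  have op : ∀ (S O : Set M) (hS : S = Y ∩ O) (hSY : S ⊆ Y), IsOpen O → IsOpenMap (inclusion hSY) := by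
    intro S O hS hSY hO
    refine (IsOpenEmbedding.mk (IsEmbedding.inclusion hSY) ?_).isOpenMap
    rw [range_inclusion]
    have : {x : ↥Y | (x : M) ∈ S} = Subtype.val ⁻¹' O := by
      ext x
      simp [hS]
    rw [this]
    exact hO.preimage continuous_subtype_val
  let F : ↥P ⊕ ↥Q → ↥Y := Sum.elim (inclusion hPY) (inclusion hQY)
  have hFc : Continuous F := (continuous_inclusion hPY).sumElim (continuous_inclusion hQY)
  have hFo : IsOpenMap F := (op P O₁ hP hPY h1).sumElim (op Q O₂ hQ hQY h2)
  have hFb : Function.Bijective F := by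
    constructor
    · apply Function.Injective.sumElim (inclusion_injective hPY) (inclusion_injective hQY)
      intro x y he
      have he' : (x : M) = y := congrArg Subtype.val he
      exact Set.disjoint_left.1 hd x.2 (he' ▸ y.2)
    · intro y
      rcases hY y.2 with h | h
      · exact ⟨Sum.inl ⟨y, h⟩, rfl⟩
      · exact ⟨Sum.inr ⟨y, h⟩, rfl⟩
  exact ⟨((Equiv.ofBijective F hFb).toHomeomorphOfContinuousOpen hFc hFo).symm⟩

end Dyn

section Fin7
set_option linter.unusedSectionVars false

variable {M : Type*} [TopologicalSpace M] [T2Space M] {n : ℕ}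

lemma homeo_attr (φ : EuclideanSpace ℝ (Fin n) → M) (hφ : IsOpenEmbedding φ) (G : M ≃ₜ M)
    (hG : G (φ 0) = φ 0) {a b : ℝ} (ha : 0 < a) (hab : a < b)
    (hb : ∀ x, ‖x‖ ≤ b → G (φ x) ∈ φ '' Metric.ball 0 a) :
    Nonempty (↥(φ '' Metric.closedBall 0 a \ ⋂ j : ℕ, ⇑(G ^ j) '' (φ '' Metric.closedBall 0 a)) ≃ₜ
      ↥(Metric.sphere (0 : EuclideanSpace ℝ (Fin n)) 1) × ↥(Set.Ici (0:ℝ))) := by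
  obtain ⟨e1⟩ := attr_part φ hφ G hG ha hab hb
  have hset : φ '' Metric.closedBall 0 a \ {φ 0} = φ '' {x | ‖x‖ ∈ Ioc 0 a} := by
    ext y
    constructor
    · rintro ⟨⟨x, hx, rfl⟩, hy⟩
      refine ⟨x, ⟨?_, by simpa using hx⟩, rfl⟩
      rw [norm_pos_iff]
      rintro rfl
      exact hy rfl
    · rintro ⟨x, hx, rfl⟩
      refine ⟨⟨x, by simpa using hx.2, rfl⟩, fun hc => ?_⟩
      have : x = 0 := hφ.injective hc
      rw [this] at hx
      simp at hx
  obtain ⟨r⟩ := ray_Ioc a ha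
  obtain ⟨e2⟩ := polar (n := n) (Ioc 0 a) (fun s hs => hs.1) r
  exact ⟨e1.trans ((Homeomorph.setCongr hset).trans ((hφ.isEmbedding.homeomorphImage _).symm.trans e2))⟩

lemma homeo_rep (φ : EuclideanSpace ℝ (Fin n) → M) (hφ : IsOpenEmbedding φ) (G : M ≃ₜ M)
    (hG : G (φ 0) = φ 0) {c d : ℝ} (hc : 0 < c) (hcd : c < d)
    (hd : ∀ x, ‖x‖ ≤ d → G.symm (φ x) ∈ φ '' Metric.ball 0 c) :
    Nonempty (↥(repR φ G c \ φ '' Metric.ball 0 c) ≃ₜ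
      ↥(Metric.sphere (0 : EuclideanSpace ℝ (Fin n)) 1) × ↥(Set.Ici (0:ℝ))) := by
  obtain ⟨e1⟩ := rep_part φ hφ G hG hc hcd hd
  obtain ⟨r⟩ := ray_Ico c d hcd
  obtain ⟨e2⟩ := polar (n := n) (Ico c d) (fun s hs => hc.trans_le hs.1) r
  exact ⟨e1.symm.trans ((hφ.isEmbedding.homeomorphImage _).symm.trans e2)⟩

lemma shell_homeo (φ : EuclideanSpace ℝ (Fin n) → M) (hφ : IsOpenEmbedding φ) {c a : ℝ} (hc : 0 < c) (hca : c < a) :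
    Nonempty (↥(φ '' shell n c a) ≃ₜ
      ↥(Metric.sphere (0 : EuclideanSpace ℝ (Fin n)) 1) × ↥(Set.Icc (0:ℝ) 1)) := by
  obtain ⟨r⟩ := seg_Icc c a hca
  obtain ⟨e2⟩ := polar (n := n) (Icc c a) (fun s hs => hc.trans_le hs.1) r
  exact ⟨(hφ.isEmbedding.homeomorphImage _).symm.trans e2⟩

lemma compl_homeo (φ : EuclideanSpace ℝ (Fin n) → M) (hφ : IsOpenEmbedding φ) (G : M ≃ₜ M)
    (hG : G (φ 0) = φ 0) {a b c d : ℝ} (hc : 0 < c) (hcd : c < d) (hda : d < a) (hab : a < b)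
    (hb : ∀ x, ‖x‖ ≤ b → G (φ x) ∈ φ '' Metric.ball 0 a)
    (hd : ∀ x, ‖x‖ ≤ d → G.symm (φ x) ∈ φ '' Metric.ball 0 c) :
    Nonempty (↥(φ '' shell n c a \ ⋂ j : ℕ, ⇑(G ^ j) '' (φ '' shell n c a)) ≃ₜ
      ↥(subsetBoundary n (φ '' shell n c a)) × ↥(Set.Ici (0 : ℝ))) := by
  have ha : 0 < a := by linarith
  have hca : c < a := by linarith
  obtain ⟨e1⟩ := homeo_attr φ hφ G hG ha hab hb
  obtain ⟨e2⟩ := homeo_rep φ hφ G hG hc hcd hd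
  obtain ⟨e3⟩ := subset_bdry hc hca φ hφ
  set D := φ '' Metric.closedBall 0 a with hD
  set B := φ '' Metric.ball 0 c with hB
  set K := ⋂ j : ℕ, ⇑(G ^ j) '' D with hK
  set C := φ '' shell n c a with hCdef
  have hCe : C = D \ B := by
    rw [hD, hB, hCdef, ← image_sdiff hφ.injective]
    congr 1
    ext x
    simp [shell, and_comm]
  have hBD : B ⊆ D := image_mono (Metric.ball_subset_closedBall.trans (Metric.closedBall_subset_closedBall hca.le))
  have hGD : ∀ j, ∀ x ∈ D, (G^j) x ∈ D := by
    intro j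
    induction j with
    | zero => intro x hx; exact hx
    | succ j ih =>
      rintro _ ⟨x, hx, rfl⟩
      rw [hpow_succ]
      apply ih
      exact image_mono Metric.ball_subset_closedBall (hb x (by simp at hx; linarith))
  have hBG : ∀ j, ∀ x ∈ B, ∃ y ∈ B, (G^j) y = x := by
    intro j
    induction j with
    | zero => intro x hx; exact ⟨x, hx, rfl⟩
    | succ j ih =>
      intro x hx
      obtain ⟨y, ⟨w, hw, rfl⟩, rfl⟩ := ih x hx
      obtain ⟨z, hz, hze⟩ := rep_sub φ G hd j w (by simp at hw; linarith)
      exact ⟨z, hz, hze⟩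
  have hRK : repR φ G c ⊆ K := by
    intro x hx
    obtain ⟨j, y, hy, rfl⟩ := mem_iUnion.1 hx
    rw [hK, mem_iInter]
    intro i
    obtain ⟨z, hz, rfl⟩ := hBG i y hy
    rw [← hpow_add, add_comm, hpow_add]
    exact mem_image_of_mem _ (hGD j z (hBD hz))
  have hKD : K ⊆ D := by
    intro x hx
    obtain ⟨y, hy, rfl⟩ := mem_iInter.1 hx 0
    exact hy
  have hBR : B ⊆ repR φ G c := fun x hx => mem_iUnion.2 ⟨0, x, hx, rfl⟩
  have hA : ∀ x, x ∈ (⋂ j : ℕ, ⇑(G ^ j) '' C) ↔ x ∈ K ∧ x ∉ repR φ G c := by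
    intro x
    have : ∀ j : ℕ, ⇑(G ^ j) '' C = ⇑(G ^ j) '' D \ ⇑(G ^ j) '' B := by
      intro j; rw [hCe, image_sdiff (G^j).injective]
    simp only [mem_iInter, this, mem_sdiff, hK, repR, mem_iUnion, not_exists, forall_and, hB]
  have hDc : IsCompact D := (isCompact_closedBall _ _).image hφ.continuous
  have hKc : IsClosed K := isClosed_iInter fun j => (hDc.image (G^j).continuous).isClosed
  have hRo : IsOpen (repR φ G c) := isOpen_iUnion fun j => (G^j).isOpenMap _ (hφ.isOpenMap _ Metric.isOpen_ball)
  obtain ⟨e0⟩ := split_sum (C \ ⋂ j : ℕ, ⇑(G ^ j) '' C) (D \ K) (repR φ G c \ B) Kᶜ (repR φ G c)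
    (by
      ext x
      have h1 := @hRK x
      have h2 := @hBR x
      have h3 := hA x
      have h4 : x ∈ C ↔ x ∈ D ∧ x ∉ B := by rw [hCe]; rfl
      simp only [mem_sdiff, mem_inter_iff, mem_compl_iff]
      tauto)
    (by
      ext x
      have h1 := @hRK x
      have h2 := @hBR x
      have h3 := hA x
      have h4 : x ∈ C ↔ x ∈ D ∧ x ∉ B := by rw [hCe]; rfl
      have h5 := @hKD x
      simp only [mem_sdiff, mem_inter_iff]
      tauto)
    (by
      intro x
      have h3 := hA x
      have h4 : x ∈ C ↔ x ∈ D ∧ x ∉ B := by rw [hCe]; rfl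
      simp only [mem_sdiff, mem_union]
      tauto)
    (by
      rw [Set.disjoint_left]
      intro x hx hx'
      exact hx.2 (hRK hx'.1))
    hKc.isOpen_compl hRo
  exact ⟨e0.trans ((e1.sumCongr e2).trans (Homeomorph.sumProdDistrib.symm.trans
    (e3.symm.prodCongr (Homeomorph.refl _))))⟩

lemma hopf_one (φ : EuclideanSpace ℝ (Fin n) → M) (hφ : IsOpenEmbedding φ) (g : M ≃ₜ M)
    (hrep : IsRepeller g {φ 0}) {a b : ℝ} (ha : 0 < a) (hab : a < b) (m : ℕ) (hm : 1 ≤ m)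
    (hb : ∀ k, m ≤ k → ∀ x, ‖x‖ ≤ b → (g ^ k) (φ x) ∈ φ '' Metric.ball 0 a) :
    ∃ K : Set M, (IsCompact K ∧ IsAttractor g K ∧ ∃ C : Set M, IsCompact C ∧
          Nonempty (↥C ≃ₜ ↥(Metric.sphere (0 : EuclideanSpace ℝ (Fin n)) 1) × ↥(Set.Icc (0 : ℝ) 1)) ∧
          IsSpine n C K) ∧ ∀ k, K ⊆ ⇑(g ^ k) '' (φ '' Metric.closedBall 0 b) := by
  have hrep' : IsAttractor g.symm {φ 0} := hrep
  have hgs : g.symm (φ 0) = φ 0 := by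
    obtain ⟨_, U, _, hU⟩ := hrep'
    exact omega_fix g.symm _ U hU
  have hg : g (φ 0) = φ 0 := by rw [← g.eq_symm_apply, hgs]
  obtain ⟨ρ, hρ, hr⟩ := attr_unif φ hφ g.symm hgs hrep'
  obtain ⟨d, hd0, hdm⟩ := exists_between (lt_min hρ ha)
  have hdρ : d < ρ := hdm.trans_le (min_le_left _ _)
  have hda : d < a := hdm.trans_le (min_le_right _ _)
  obtain ⟨c, hc, hcd⟩ := exists_between hd0
  obtain ⟨k0, hk0⟩ := hr c hc
  set N := max m k0 with hN
  have hN1 : 1 ≤ N := hm.trans (le_max_left _ _)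
  set C := φ '' shell n c a with hC
  have hCc : IsCompact C := by
    refine IsCompact.image ?_ hφ.continuous
    refine (isCompact_closedBall (0 : EuclideanSpace ℝ (Fin n)) a).of_isClosed_subset ?_ ?_
    · exact (isClosed_le continuous_const continuous_norm).inter (isClosed_le continuous_norm continuous_const)
    · intro x hx; simpa using hx.2
  have hint : φ '' {x | d < ‖x‖ ∧ ‖x‖ < a} ⊆ interior C := by
    apply interior_maximal
    · exact image_mono (fun x hx => ⟨(hcd.trans hx.1).le, hx.2.le⟩)
    · exact hφ.isOpenMap _ ((isOpen_lt continuous_const continuous_norm).inter (isOpen_lt continuous_norm continuous_const))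
  have htr : ∀ k, N ≤ k → ∀ x ∈ C, (g ^ k) x ∈ interior C := by
    rintro k hk _ ⟨x, hx, rfl⟩
    obtain ⟨y, hy, hye⟩ := hb k ((le_max_left _ _).trans hk) x (by linarith [hx.2])
    rw [← hye]
    apply hint
    refine ⟨y, ⟨?_, by simpa using hy⟩, rfl⟩
    by_contra hlt
    push Not at hlt
    obtain ⟨z, hz, hze⟩ := hk0 k ((le_max_right _ _).trans hk) y (by linarith)
    rw [hye, hpow_symm] at hze
    rw [hφ.injective hze] at hz
    simp at hz
    linarith [hx.1]
  obtain ⟨t1, t2, t3⟩ := trap g C hCc N hN1 htr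
  refine ⟨_, ⟨t1.1, t1, C, hCc, shell_homeo φ hφ hc (hcd.trans hda), t2, ?_⟩, fun k => (t3 k).trans ?_⟩
  · refine compl_homeo φ hφ (g ^ N) (hpow_fix g hg N) hc hcd hda hab (hb N (le_max_left _ _)) ?_
    intro x hx
    have : (g ^ N).symm (φ x) = (g.symm ^ N) (φ x) := by
      have h := hpow_symm g.symm N (φ x)
      rw [(g^N).symm_apply_eq]
      exact h.symm
    rw [this]
    exact hk0 N (le_max_right _ _) x (by linarith)
  · apply image_mono
    apply image_mono
    intro x hx
    simp
    linarith [hx.2]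

end Fin7

/-- **Hopf bifurcation of a fixed point.** If `p` is an asymptotically stable fixed
point of `f₀` and `{p}` is a repeller of `f_λ` for every `λ > 0`, then for all
sufficiently small `λ > 0` there is a compact attractor `K_λ` of `f_λ` which is a
topological spine of a compact subset of `M` homeomorphic to `S^{n-1} × [0,1]`, and
`K_λ` converges to `{p}` upper semicontinuously as `λ → 0`. -/
theorem hopf_fixed_point
    {n : ℕ} (hn : 1 ≤ n)
    {M : Type*} [MetricSpace M] [LocallyCompactSpace M]
    (hM : LocallyEuclidean n M)
    (f : unitInterval → M ≃ₜ M) (hf : ContinuousFamily f)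
    (p : M) (hfix : f 0 p = p) (hattr : IsAttractor (f 0) {p})
    (hhopf : ∀ lam : unitInterval, 0 < (lam : ℝ) → IsRepeller (f lam) {p}) :
    ∃ lam₀ : ℝ, 0 < lam₀ ∧ ∃ Kfam : unitInterval → Set M,
      (∀ lam : unitInterval, 0 < (lam : ℝ) → (lam : ℝ) < lam₀ →
        IsCompact (Kfam lam) ∧ IsAttractor (f lam) (Kfam lam) ∧
        ∃ C : Set M, IsCompact C ∧
          Nonempty (↥C ≃ₜ
            ↥(Metric.sphere (0 : EuclideanSpace ℝ (Fin n)) 1) × ↥(Set.Icc (0 : ℝ) 1)) ∧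
          IsSpine n C (Kfam lam)) ∧
      (∀ V : Set M, V ∈ 𝓝ˢ ({p} : Set M) → ∃ lam₁ : ℝ, 0 < lam₁ ∧
        ∀ lam : unitInterval, 0 < (lam : ℝ) → (lam : ℝ) < lam₁ → Kfam lam ⊆ V) := by
  obtain ⟨φ, hφ, hp⟩ := chart hM p
  subst hp
  obtain ⟨ρ, hρ, hr⟩ := attr_unif φ hφ (f 0) hfix hattr
  obtain ⟨b, hb0, hbρ⟩ := exists_between hρ
  obtain ⟨a, ha, hab⟩ := exists_between hb0
  have hQc : IsCompact (φ '' Metric.closedBall 0 b) := (isCompact_closedBall _ _).image hφ.continuous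
  have hop : ∀ r : ℝ, IsOpen (φ '' Metric.ball 0 r) := fun r => hφ.isOpenMap _ Metric.isOpen_ball
  obtain ⟨m0, hm0⟩ := hr a ha
  set m := m0 + 1 with hm
  have hev : ∀ᶠ l in 𝓝 (0 : unitInterval), ∀ k ∈ Finset.Ico m (2 * m),
      ∀ x ∈ φ '' Metric.closedBall 0 b, (f l ^ k) x ∈ φ '' Metric.ball 0 a := by
    rw [Filter.eventually_all_finset]
    intro k hk
    apply persist f hf k _ _ hQc (hop a)
    rintro _ ⟨x, hx, rfl⟩
    rw [Finset.mem_Ico] at hk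
    exact hm0 k (by omega) x (by simp at hx; linarith)
  obtain ⟨l0, hl0, hl⟩ := ev_small hev
  have key : ∀ lam : unitInterval, 0 < (lam : ℝ) → (lam : ℝ) < l0 → ∃ K : Set M,
      (IsCompact K ∧ IsAttractor (f lam) K ∧ ∃ C : Set M, IsCompact C ∧
        Nonempty (↥C ≃ₜ ↥(Metric.sphere (0 : EuclideanSpace ℝ (Fin n)) 1) × ↥(Set.Icc (0 : ℝ) 1)) ∧
        IsSpine n C K) ∧ ∀ k, K ⊆ ⇑(f lam ^ k) '' (φ '' Metric.closedBall 0 b) := by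
    intro lam h0 h1
    refine hopf_one φ hφ (f lam) (hhopf lam h0) ha hab m (by omega) ?_
    intro k hk x hx
    refine semi (f lam) (φ '' Metric.closedBall 0 b) (φ '' Metric.ball 0 a) ?_ m (by omega) ?_ k hk _
      ⟨x, by simpa using hx, rfl⟩
    · exact image_mono (Metric.ball_subset_closedBall.trans (Metric.closedBall_subset_closedBall hab.le))
    · intro k h2 h3
      exact hl lam h1 k (Finset.mem_Ico.2 ⟨h2, h3⟩)
  choose! Kf hK1 hK2 using key
  refine ⟨l0, hl0, Kf, hK1, ?_⟩
  intro V hV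
  rw [nhdsSet_singleton] at hV
  obtain ⟨r, hr0, hrV⟩ := Metric.mem_nhds_iff.1 (hφ.continuous.continuousAt hV)
  obtain ⟨k, hk⟩ := hr r hr0
  obtain ⟨l1, hl1, hl1'⟩ := ev_small (persist f hf k (φ '' Metric.closedBall 0 b) (φ '' Metric.ball 0 r) hQc (hop r)
    (by
      rintro _ ⟨x, hx, rfl⟩
      exact hk k le_rfl x (by simp at hx; linarith)))
  refine ⟨min l0 l1, lt_min hl0 hl1, fun lam h0 h1 => ?_⟩
  intro y hy
  obtain ⟨x, hx, rfl⟩ := hK2 lam h0 (h1.trans_le (min_le_left _ _)) k hy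
  obtain ⟨z, hz, hze⟩ := hl1' lam (h1.trans_le (min_le_right _ _)) x hx
  rw [← hze]
  exact hrV hz
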